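/- arXiv:math/9802119 — 5 statements merged into one kernel-verified Lean document; each statement's English description precedes it below -/
import Mathlib

section
/- The number of standard Young tableaux of rectangular shape with k rows and n columns (i.e., shape n^k) equals (kn)! · (1! · 2! ⋯ (n-1)!) / (k! · (k+1)! ⋯ (k+n-1)!). -/
/-- A standard Young tableau of rectangular shape `n^k` (`k` rows, `n` columns),
encoded as a bijective filling of the `k × n` rectangle with `0, …, kn-1`,
strictly increasing along rows and down columns. -/
def IsSYT (k n : ℕ) (T : Fin k × Fin n → Fin (k * n)) : Prop :=
  Function.Bijective T ∧
  (∀ (i : Fin k) (j j' : Fin n), j < j' → T (i, j) < T (i, j')) ∧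
  (∀ (i i' : Fin k) (j : Fin n), i < i' → T (i, j) < T (i', j))

open Finset Matrix in
/-- The weighted sum of the Vandermonde determinants obtained by decreasing one variable by `1`. -/
theorem sum_mul_det_vandermonde_update_sub_one {R : Type*} [CommRing R] [IsDomain R] {n : ℕ}
    (v : Fin n → R) :
    ∑ i, v i * (vandermonde (Function.update v i (v i - 1))).det =
      (∑ i, v i - ∑ i : Fin n, ((i : ℕ) : R)) * (vandermonde v).det := by
  have key (w : Fin n → R) : (vandermonde w).det =
      ∑ σ : Equiv.Perm (Fin n), Equiv.Perm.sign σ •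
        ∏ i, (descPochhammer R (σ i : ℕ)).eval (w i) := by
    rw [det_eval_matrixOfPolynomials_eq_det_vandermonde w
      (fun j => descPochhammer R (j : ℕ)) (fun j => descPochhammer_natDegree R j)
      (fun j => monic_descPochhammer R j), ← det_transpose, det_apply]
    rfl
  have shift (x : R) (m : ℕ) : x * (descPochhammer R m).eval (x - 1) =
      (x - m) * (descPochhammer R m).eval x := by
    have h₁ := congrArg (Polynomial.eval x) (descPochhammer_succ_left R m)
    have h₂ := congrArg (Polynomial.eval x) (descPochhammer_succ_right R m)
    simp only [Polynomial.eval_mul, Polynomial.eval_comp, Polynomial.eval_sub, Polynomial.eval_X,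
      Polynomial.eval_one, Polynomial.eval_natCast] at h₁ h₂
    rw [← h₁, h₂, mul_comm]
  have hterm (i : Fin n) : v i * (vandermonde (Function.update v i (v i - 1))).det =
      ∑ σ : Equiv.Perm (Fin n), (v i - ((σ i : ℕ) : R)) * (Equiv.Perm.sign σ •
        ∏ i, (descPochhammer R (σ i : ℕ)).eval (v i)) := by
    rw [key, mul_sum]
    refine sum_congr rfl fun σ _ => ?_
    rw [mul_smul_comm, mul_smul_comm]
    congr 1
    rw [← mul_prod_erase univ _ (mem_univ i), ← mul_prod_erase univ _ (mem_univ i), ← mul_assoc,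
      ← mul_assoc, Function.update_self, shift]
    congr 1
    refine prod_congr rfl fun j hj => ?_
    rw [Function.update_of_ne (ne_of_mem_erase hj)]
  simp_rw [hterm]
  rw [sum_comm, key v, mul_sum]
  refine sum_congr rfl fun σ _ => ?_
  rw [← sum_mul, sum_sub_distrib, Equiv.sum_comp σ (fun i : Fin n => ((i : ℕ) : R))]

/-- The enumerations of `s` by `Fin m` in which no entry lies below an earlier one. -/
def LinearEnum {α : Type*} [PartialOrder α] (m : ℕ) (s : Set α) : Type _ :=
  {f : Fin m → α // Set.range f = s ∧ ∀ a b, a < b → ¬ f b ≤ f a}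

instance {α : Type*} [PartialOrder α] [Finite α] (m : ℕ) (s : Set α) :
    Finite (LinearEnum m s) :=
  Subtype.finite

/-- Splitting off the last entry, a maximal element of `s`. -/
def linearEnumSuccEquiv {α : Type*} [PartialOrder α] (m : ℕ) (s : Set α) :
    LinearEnum (m + 1) s ≃ Σ x : {x // Maximal (· ∈ s) x}, LinearEnum m (s \ {x.1}) where
  toFun f := ⟨⟨f.1 (Fin.last m), by
      obtain ⟨f, rfl, hf⟩ := f
      refine ⟨⟨_, rfl⟩, ?_⟩
      rintro _ ⟨a, rfl⟩ h
      rcases (Fin.le_last a).lt_or_eq with ha | rfl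
      · exact absurd h (hf _ _ ha)
      · exact le_rfl⟩,
    ⟨fun a => f.1 a.castSucc, by
      obtain ⟨f, rfl, hf⟩ := f
      refine ⟨?_, fun a b hab => hf _ _ (by simpa using hab)⟩
      ext y
      constructor
      · rintro ⟨a, rfl⟩
        exact ⟨⟨_, rfl⟩, fun h => hf _ _ (Fin.castSucc_lt_last a) (le_of_eq h.symm)⟩
      · rintro ⟨⟨a, rfl⟩, h⟩
        rcases Fin.eq_castSucc_or_eq_last a with ⟨a, rfl⟩ | rfl
        · exact ⟨a, rfl⟩
        · exact absurd rfl h⟩⟩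
  invFun p := ⟨Fin.snoc (α := fun _ => α) p.2.1 p.1.1, by
    obtain ⟨⟨x, hx⟩, ⟨g, hg, hg'⟩⟩ := p
    dsimp only at hg ⊢
    refine ⟨?_, ?_⟩
    · rw [Fin.range_snoc, hg, Set.insert_sdiff_singleton, Set.insert_eq_of_mem hx.1]
    · intro a b hab h
      induction b using Fin.lastCases with
      | last =>
        induction a using Fin.lastCases with
        | last => exact absurd hab (lt_irrefl _)
        | cast a =>
          simp only [Fin.snoc_last, Fin.snoc_castSucc] at h
          have ha : g a ∈ s \ {x} := hg ▸ ⟨a, rfl⟩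
          exact ha.2 (le_antisymm (hx.2 ha.1 h) h)
      | cast b =>
        induction a using Fin.lastCases with
        | last => exact absurd hab (not_lt_of_ge (Fin.le_last _))
        | cast a =>
          simp only [Fin.snoc_castSucc] at h
          exact hg' a b (by simpa using hab) h⟩
  left_inv f := Subtype.ext (Fin.snoc_init_self (α := fun _ => α) f.1)
  right_inv p := by
    obtain ⟨⟨x, hx⟩, ⟨g, hg, hg'⟩⟩ := p
    have h₁ : (Fin.snoc (α := fun _ => α) g x : Fin (m + 1) → α) (Fin.last m) = x :=
      Fin.snoc_last _ _
    have h₂ : (fun a : Fin m => (Fin.snoc (α := fun _ => α) g x : Fin (m + 1) → α) a.castSucc) =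
      g := funext fun a => Fin.snoc_castSucc _ _ _
    refine Sigma.ext (Subtype.ext h₁) ?_
    refine (Subtype.heq_iff_coe_eq ?_).2 h₂
    intro f
    dsimp only
    rw [h₁]

open Classical in
theorem card_linearEnum_succ {α : Type*} [PartialOrder α] [Fintype α] (m : ℕ) (s : Set α) :
    Nat.card (LinearEnum (m + 1) s) =
      ∑ x : α, if Maximal (· ∈ s) x then Nat.card (LinearEnum m (s \ {x})) else 0 := by
  rw [Nat.card_congr (linearEnumSuccEquiv m s), Nat.card_sigma, ← Finset.sum_filter]
  exact (Finset.sum_subtype _ (by simp) fun x => Nat.card (LinearEnum m (s \ {x}))).symm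

theorem card_linearEnum_zero {α : Type*} [PartialOrder α] :
    Nat.card (LinearEnum 0 (∅ : Set α)) = 1 := by
  rw [Nat.card_eq_one_iff_unique]
  exact ⟨⟨fun f g => Subtype.ext (Subsingleton.elim _ _)⟩,
    ⟨⟨Fin.elim0, by simp, fun a => a.elim0⟩⟩⟩

/-- The subset of the `k × n` rectangle whose `j`-th column consists of the first `c j` cells. -/
def columnShape (k : ℕ) {n : ℕ} (c : Fin n → ℕ) : Set (Fin k × Fin n) :=
  {x | (x.1 : ℕ) < c x.2}

/-- The column heights shifted so as to become strictly decreasing. -/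
def shiftedHeight {n : ℕ} (c : Fin n → ℕ) (j : Fin n) : ℕ := c j + (j.rev : ℕ)

theorem maximal_columnShape_iff {k n : ℕ} {c : Fin n → ℕ} (hk : ∀ j, c j ≤ k)
    (i : Fin k) (j : Fin n) :
    Maximal (· ∈ columnShape k c) (i, j) ↔ (i : ℕ) + 1 = c j ∧ ∀ j', j < j' → c j' < c j := by
  constructor
  · rintro ⟨h, hmax⟩
    have h : (i : ℕ) < c j := h
    have hi : (i : ℕ) + 1 = c j := by
      by_contra hne
      have hlt : (i : ℕ) + 1 < c j := by omega
      have := (hmax (y := (⟨i + 1, hlt.trans_le (hk j)⟩, j)) hlt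
        ⟨Fin.le_def.2 (by simp), le_rfl⟩).1
      simp [Fin.le_def] at this
    refine ⟨hi, fun j' hj => ?_⟩
    by_contra hle
    have := (hmax (y := (i, j')) (show (i : ℕ) < c j' by omega) ⟨le_rfl, hj.le⟩).2
    exact absurd hj (not_lt_of_ge this)
  · rintro ⟨hi, hj⟩
    refine ⟨show (i : ℕ) < c j by omega, ?_⟩
    rintro ⟨i', j'⟩ h ⟨h₁, h₂⟩
    have h : (i' : ℕ) < c j' := h
    have h₁ : (i : ℕ) ≤ i' := h₁
    rcases (show j ≤ j' from h₂).lt_or_eq with hlt | rfl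
    · have := hj _ hlt
      omega
    · exact ⟨Fin.le_def.2 (show (i' : ℕ) ≤ i by omega), le_rfl⟩

theorem columnShape_diff_singleton {k n : ℕ} {c : Fin n → ℕ} {i : Fin k} {j : Fin n}
    (h : (i : ℕ) + 1 = c j) :
    columnShape k c \ {(i, j)} = columnShape k (Function.update c j i) := by
  ext ⟨i', j'⟩
  by_cases hj : j' = j
  · subst hj
    simp only [columnShape, Set.mem_sdiff, Set.mem_ofPred_eq, Set.mem_singleton_iff, Prod.mk.injEq,
      and_true, Function.update_self, Fin.ext_iff]
    omega
  · simp [columnShape, hj]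

open Finset Matrix in
/-- The determinantal form of the hook length formula, normalised by the empty shape. -/
theorem card_linearEnum_columnShape (k n m : ℕ) (c : Fin n → ℕ) (hc : Antitone c)
    (hk : ∀ j, c j ≤ k) (hm : ∑ j, c j = m) :
    (Nat.card (LinearEnum m (columnShape k c)) : ℤ) * (∏ j, ((shiftedHeight c j).factorial : ℤ)) *
        (vandermonde fun j : Fin n => ((j.rev : ℕ) : ℤ)).det =
      m.factorial * (vandermonde fun j => (shiftedHeight c j : ℤ)).det *
        ∏ j : Fin n, ((j.rev : ℕ).factorial : ℤ) := by
  classical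
  induction m generalizing c with
  | zero =>
    have h0 : ∀ j, c j = 0 := by simpa using hm
    have hS : columnShape k c = ∅ := by ext; simp [columnShape, h0]
    rw [hS, card_linearEnum_zero]
    simp [shiftedHeight, h0, mul_comm]
  | succ m ih =>
    set D₀ := (vandermonde fun j : Fin n => ((j.rev : ℕ) : ℤ)).det
    set P₀ := ∏ j : Fin n, ((j.rev : ℕ).factorial : ℤ)
    set v : Fin n → ℤ := fun j => (shiftedHeight c j : ℤ) with hv
    have hcol (j : Fin n) :
        ((∑ i : Fin k, if Maximal (· ∈ columnShape k c) (i, j) then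
          Nat.card (LinearEnum m (columnShape k c \ {(i, j)})) else 0 : ℕ) : ℤ) *
          (∏ j, ((shiftedHeight c j).factorial : ℤ)) * D₀ =
        m.factorial * (v j * (vandermonde (Function.update v j (v j - 1))).det) * P₀ := by
      by_cases hcorner : 0 < c j ∧ ∀ j', j < j' → c j' < c j
      · obtain ⟨hpos, hj⟩ := hcorner
        have hck := hk j
        let i₀ : Fin k := ⟨c j - 1, by omega⟩
        have hi₀ : (i₀ : ℕ) + 1 = c j := Nat.sub_add_cancel hpos
        rw [sum_eq_single i₀, if_pos ((maximal_columnShape_iff hk _ _).2 ⟨hi₀, hj⟩),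
          columnShape_diff_singleton hi₀]
        · set c' := Function.update c j (i₀ : ℕ) with hc'
          have hc'j : c' j = i₀ := Function.update_self ..
          have hc'ne : ∀ j', j' ≠ j → c' j' = c j' := fun j' h => Function.update_of_ne h ..
          have hanti : Antitone c' := by
            intro a b hab
            by_cases ha : a = j
            · by_cases hb : b = j
              · rw [ha, hb]
              · subst ha
                rw [hc'j, hc'ne b hb]
                have := hj b (lt_of_le_of_ne hab (Ne.symm hb))
                omega
            · by_cases hb : b = j
              · subst hb
                rw [hc'j, hc'ne a ha]
                have := hc hab
                omega
              · rw [hc'ne a ha, hc'ne b hb]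
                exact hc hab
          have hle : ∀ j', c' j' ≤ k := by
            intro j'
            by_cases h : j' = j
            · subst h
              rw [hc'j]
              omega
            · rw [hc'ne j' h]
              exact hk j'
          have hsum : ∑ j, c' j = m := by
            have h₁ := add_sum_erase univ c (mem_univ j)
            have h₂ := add_sum_erase univ c' (mem_univ j)
            have h₃ : ∑ x ∈ univ.erase j, c' x = ∑ x ∈ univ.erase j, c x :=
              sum_congr rfl fun x hx => hc'ne x (ne_of_mem_erase hx)
            omega
          have hprod : ∏ j, ((shiftedHeight c j).factorial : ℤ) =
              v j * ∏ j, ((shiftedHeight c' j).factorial : ℤ) := by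
            rw [← mul_prod_erase univ _ (mem_univ j), ← mul_prod_erase univ _ (mem_univ j),
              ← mul_assoc]
            congr 1
            · have : shiftedHeight c j = shiftedHeight c' j + 1 := by
                simp only [shiftedHeight, hc'j]
                omega
              simp only [hv]
              rw [this, Nat.factorial_succ]
              push_cast
              ring
            · refine prod_congr rfl fun x hx => ?_
              simp only [shiftedHeight, hc'ne x (ne_of_mem_erase hx)]
          have hvec : Function.update v j (v j - 1) = fun j => (shiftedHeight c' j : ℤ) := by
            ext x
            by_cases hx : x = j
            · subst hx
              simp only [Function.update_self, hv, shiftedHeight, hc'j]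
              push_cast
              omega
            · simp only [Function.update_of_ne hx, hv, shiftedHeight, hc'ne x hx]
          rw [hvec, hprod]
          linear_combination v j * ih c' hanti hle hsum
        · intro i _ hi
          rw [if_neg]
          rw [maximal_columnShape_iff hk]
          rintro ⟨h, -⟩
          exact hi (Fin.ext (by omega))
        · simp
      · have hzero : v j * (vandermonde (Function.update v j (v j - 1))).det = 0 := by
          by_cases hlast : (j : ℕ) + 1 < n
          · let j₁ : Fin n := ⟨j + 1, hlast⟩
            have hlt : j < j₁ := Fin.lt_def.2 (Nat.lt_succ_self _)
            have heq : c j₁ = c j := by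
              have h₁ := hc hlt.le
              by_contra hne
              refine hcorner ⟨by omega, fun j' hj' => ?_⟩
              have h₂ : c j' ≤ c j₁ := hc (Fin.le_def.2 (Nat.succ_le_of_lt hj'))
              omega
            rw [mul_eq_zero, det_vandermonde_eq_zero_iff]
            refine Or.inr ⟨j, j₁, ?_, hlt.ne⟩
            rw [Function.update_self, Function.update_of_ne hlt.ne']
            simp only [hv, shiftedHeight, heq, Fin.val_rev, j₁]
            omega
          · have h0 : c j = 0 := by
              by_contra hne
              refine hcorner ⟨by omega, fun j' hj' => ?_⟩
              have := Fin.lt_def.1 hj'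
              omega
            have : v j = 0 := by
              simp only [hv, shiftedHeight, h0, Fin.val_rev]
              omega
            rw [this, zero_mul]
        rw [hzero, sum_eq_zero]
        · simp
        · intro i _
          rw [if_neg]
          rw [maximal_columnShape_iff hk]
          rintro ⟨h, h'⟩
          exact hcorner ⟨by omega, h'⟩
    have hN : ∑ j, v j - ∑ j : Fin n, ((j : ℕ) : ℤ) = m + 1 := by
      have h₁ : ∑ j : Fin n, ((j.rev : ℕ) : ℤ) = ∑ j : Fin n, ((j : ℕ) : ℤ) :=
        Equiv.sum_comp Fin.revPerm fun j : Fin n => ((j : ℕ) : ℤ)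
      simp only [hv, shiftedHeight]
      push_cast
      rw [sum_add_distrib, ← h₁, ← Nat.cast_sum, hm]
      push_cast
      ring
    rw [card_linearEnum_succ, Fintype.sum_prod_type_right, Nat.cast_sum, sum_mul, sum_mul,
      sum_congr rfl fun j _ => hcol j, ← sum_mul, ← mul_sum,
      sum_mul_det_vandermonde_update_sub_one, hN, Nat.factorial_succ]
    push_cast
    ring

theorem IsSYT.monotone {k n : ℕ} {T : Fin k × Fin n → Fin (k * n)} (hT : IsSYT k n T) :
    Monotone T := by
  rintro ⟨i, j⟩ ⟨i', j'⟩ ⟨hi, hj⟩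
  have hrow : StrictMono fun j => T (i, j) := fun _ _ h => hT.2.1 i _ _ h
  have hcol : StrictMono fun i => T (i, j') := fun _ _ h => hT.2.2 _ _ j' h
  exact (hrow.monotone hj).trans (hcol.monotone hi)

/-- A standard tableau is the inverse of a linear enumeration of the rectangle. -/
theorem card_IsSYT_eq_card_linearEnum (k n : ℕ) :
    Nat.card {T : Fin k × Fin n → Fin (k * n) // IsSYT k n T} =
      Nat.card (LinearEnum (k * n) (Set.univ : Set (Fin k × Fin n))) := by
  refine Nat.card_eq_of_bijective (fun T => ⟨(Equiv.ofBijective T.1 T.2.1).symm,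
    (Equiv.surjective _).range_eq, fun a b hab h => ?_⟩) ⟨?_, ?_⟩
  · have := T.2.monotone h
    rw [Equiv.ofBijective_apply_symm_apply T.1 T.2.1,
      Equiv.ofBijective_apply_symm_apply T.1 T.2.1] at this
    exact absurd hab (not_lt_of_ge this)
  · intro T T' h
    have h₁ := DFunLike.coe_injective (congrArg Subtype.val h)
    have h₂ := Equiv.symm_bijective.injective h₁
    exact Subtype.ext (congrArg (fun e : _ ≃ _ => (e : _ → _)) h₂)
  · rintro ⟨f, hf, hlin⟩
    have hinj : Function.Injective f := by
      intro a b hab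
      rcases lt_trichotomy a b with h | h | h
      · exact absurd hab.ge (hlin _ _ h)
      · exact h
      · exact absurd hab.le (hlin _ _ h)
    let e := Equiv.ofBijective f ⟨hinj, Set.range_eq_univ.1 hf⟩
    have hmono : StrictMono e.symm := by
      intro x y hxy
      refine lt_of_le_of_ne (le_of_not_gt fun h => ?_) (e.symm.injective.ne hxy.ne)
      refine hlin _ _ h ?_
      exact (e.apply_symm_apply x).trans_le (hxy.le.trans_eq (e.apply_symm_apply y).symm)
    refine ⟨⟨e.symm, e.symm.bijective, fun i j j' h => hmono (Prod.mk_lt_mk_iff_right.2 h),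
      fun i i' j h => hmono (Prod.mk_lt_mk_iff_left.2 h)⟩, Subtype.ext ?_⟩
    funext a
    exact (Equiv.symm_apply_eq _).2 (e.symm_apply_apply a).symm

theorem card_SYT_rectangular (k n : ℕ) :
    Nat.card {T : Fin k × Fin n → Fin (k * n) // IsSYT k n T} *
        ∏ i ∈ Finset.range n, Nat.factorial (k + i) =
      Nat.factorial (k * n) * ∏ i ∈ Finset.range n, Nat.factorial i := by
  have hS : columnShape k (fun _ : Fin n => k) = Set.univ := by
    ext x
    simp [columnShape]
  have h := card_linearEnum_columnShape k n (k * n) (fun _ => k) antitone_const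
    (fun _ => le_rfl) (by simp [mul_comm])
  have hD : (Matrix.vandermonde fun j : Fin n => (shiftedHeight (fun _ => k) j : ℤ)).det =
      (Matrix.vandermonde fun j : Fin n => ((j.rev : ℕ) : ℤ)).det := by
    rw [← Matrix.det_vandermonde_add (fun j : Fin n => ((j.rev : ℕ) : ℤ)) (k : ℤ)]
    congr 2
    funext j
    simp only [shiftedHeight]
    push_cast
    ring
  have hne : (Matrix.vandermonde fun j : Fin n => ((j.rev : ℕ) : ℤ)).det ≠ 0 := by
    rw [Matrix.det_vandermonde_ne_zero_iff]
    exact fun a b hab => Fin.rev_injective (Fin.ext (Nat.cast_injective hab))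
  have hprod (g : ℕ → ℤ) : ∏ j : Fin n, g (j.rev : ℕ) = ∏ i ∈ Finset.range n, g i := by
    rw [← Fin.prod_univ_eq_prod_range]
    exact Equiv.prod_comp Fin.revPerm fun j : Fin n => g j
  rw [hD, hS, ← card_IsSYT_eq_card_linearEnum, hprod fun i => (i.factorial : ℤ)] at h
  simp only [shiftedHeight] at h
  rw [hprod fun i => ((k + i).factorial : ℤ)] at h
  have h' := mul_right_cancel₀ hne (h.trans (mul_right_comm _ _ _))
  exact_mod_cast h'
end

section
/- The space of SL(n,f)-invariants in V^⊗n is one-dimensional, spanned by the antisymmetrized tensor ω = Σ_{σ ∈ Sₙ} sgn(σ) x_{σ(1)} ⊗ ... ⊗ x_{σ(n)}. -/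
open scoped TensorProduct

/-- Diagonal action of a matrix on the `m`-fold tensor power of `Fin n → f`. -/
noncomputable def tensorAct (f : Type*) [Field f] (n m : ℕ) (a : Matrix (Fin n) (Fin n) f) :
    (⨂[f] _ : Fin m, (Fin n → f)) →ₗ[f] ⨂[f] _ : Fin m, (Fin n → f) :=
  PiTensorProduct.map (fun _ => a.mulVecLin)

/-- The antisymmetrized tensor `ω = Σ_σ sgn σ • x_{σ 1} ⊗ ⋯ ⊗ x_{σ n}`. -/
noncomputable def omegaTensor (f : Type*) [Field f] (n : ℕ) :
    ⨂[f] _ : Fin n, (Fin n → f) :=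
  ∑ σ : Equiv.Perm (Fin n),
    (Equiv.Perm.sign σ : ℤ) • ⨂ₜ[f] i, Pi.single (σ i) (1 : f)

/-- The basis of `⨂[f]^m (Fin n → f)` of tensors of standard basis vectors. -/
noncomputable def stdTensorBasis (f : Type*) [Field f] (n m : ℕ) :
    Module.Basis (Fin m → Fin n) f (⨂[f] _ : Fin m, (Fin n → f)) :=
  Basis.piTensorProduct fun _ => Pi.basisFun f (Fin n)

lemma stdTensorBasis_apply (f : Type*) [Field f] (n m : ℕ) (p : Fin m → Fin n) :
    stdTensorBasis f n m p = ⨂ₜ[f] i, Pi.single (p i) (1 : f) := by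
  simp [stdTensorBasis]

lemma stdTensorBasis_repr_tensorAct_monomial {f : Type*} [Field f] {n m : ℕ} (d : Fin n → f)
    (τ : Equiv.Perm (Fin n)) (t : ⨂[f] _ : Fin m, (Fin n → f)) (p : Fin m → Fin n) :
    (stdTensorBasis f n m).repr
        (tensorAct f n m (Matrix.diagonal d * τ.permMatrix f) t) p =
      (∏ i, d (p i)) * (stdTensorBasis f n m).repr t (τ ∘ p) := by
  suffices h : (stdTensorBasis f n m).coord p ∘ₗ
      tensorAct f n m (Matrix.diagonal d * τ.permMatrix f) =
      (∏ i, d (p i)) • (stdTensorBasis f n m).coord (τ ∘ p) from LinearMap.congr_fun h t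
  refine PiTensorProduct.ext (MultilinearMap.ext fun v => ?_)
  simp [stdTensorBasis, tensorAct, PiTensorProduct.map_tprod, Finset.prod_mul_distrib,
    Matrix.mulVec_diagonal, Matrix.permMatrix_mulVec]

lemma repr_eq_of_forall_tensorAct_eq {f : Type*} [Field f] {n m : ℕ}
    {t : ⨂[f] _ : Fin m, (Fin n → f)}
    (ht : ∀ a : Matrix.SpecialLinearGroup (Fin n) f,
      tensorAct f n m (a : Matrix (Fin n) (Fin n) f) t = t)
    (d : Fin n → f) (τ : Equiv.Perm (Fin n)) (hd : (∏ i, d i) * (Equiv.Perm.sign τ : ℤ) = 1)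
    (p : Fin m → Fin n) :
    (stdTensorBasis f n m).repr t p =
      (∏ i, d (p i)) * (stdTensorBasis f n m).repr t (τ ∘ p) := by
  have hdet : (Matrix.diagonal d * τ.permMatrix f).det = 1 := by
    rw [Matrix.det_mul, Matrix.det_diagonal, Matrix.det_permutation, hd]
  rw [← stdTensorBasis_repr_tensorAct_monomial]
  exact congrArg (fun s => (stdTensorBasis f n m).repr s p) (ht ⟨_, hdet⟩).symm

lemma repr_eq_zero_of_not_injective {f : Type*} [Field f] [CharZero f] {n : ℕ}
    {t : ⨂[f] _ : Fin n, (Fin n → f)}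
    (ht : ∀ a : Matrix.SpecialLinearGroup (Fin n) f,
      tensorAct f n n (a : Matrix (Fin n) (Fin n) f) t = t)
    {p : Fin n → Fin n} (hp : ¬ Function.Injective p) :
    (stdTensorBasis f n n).repr t p = 0 := by
  have hs : ¬ Function.Surjective p := fun h => hp (Finite.injective_iff_surjective.2 h)
  simp only [Function.Injective, Function.Surjective, not_forall, not_exists] at hp hs
  obtain ⟨a, b, hab, hne⟩ := hp
  obtain ⟨j, hj⟩ := hs
  have hij : p a ≠ j := hj a
  let d : Fin n → f := fun k => (if k = p a then 2 else 1) * (if k = j then 2⁻¹ else 1)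
  have hd : (∏ i, d i) * (Equiv.Perm.sign (1 : Equiv.Perm (Fin n)) : ℤ) = 1 := by
    simp only [d, Finset.prod_mul_distrib]
    simp
  have h := repr_eq_of_forall_tensorAct_eq ht d 1 hd p
  have hprod : ∏ i, d (p i) = 2 ^ (Finset.univ.filter fun i => p i = p a).card := by
    simp [d, hj, Finset.prod_ite]
  have hcard : (Finset.univ.filter fun i => p i = p a).card ≠ 0 :=
    Finset.card_ne_zero_of_mem (a := a) (by simp)
  have hpow : (2 : f) ^ (Finset.univ.filter fun i => p i = p a).card ≠ 1 := by
    exact_mod_cast (Nat.one_lt_two_pow hcard).ne'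
  rw [hprod, Equiv.Perm.coe_one, Function.id_comp] at h
  exact (mul_left_eq_self₀.1 h.symm).resolve_left hpow

lemma repr_perm_of_forall_tensorAct_eq {f : Type*} [Field f] {n : ℕ}
    {t : ⨂[f] _ : Fin n, (Fin n → f)}
    (ht : ∀ a : Matrix.SpecialLinearGroup (Fin n) f,
      tensorAct f n n (a : Matrix (Fin n) (Fin n) f) t = t)
    (σ : Equiv.Perm (Fin n)) :
    (stdTensorBasis f n n).repr t σ =
      (Equiv.Perm.sign σ : ℤ) * (stdTensorBasis f n n).repr t id := by
  induction σ using Equiv.Perm.swap_induction_on with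
  | one => simp
  | swap_mul σ i j hij ih =>
    let d : Fin n → f := fun k => if k = i then -1 else 1
    have hd : ∏ k, d k = -1 := by simp [d]
    have h := repr_eq_of_forall_tensorAct_eq ht d (Equiv.swap i j)
      (by simp [hd, Equiv.Perm.sign_swap hij]) σ
    rw [Equiv.prod_comp σ d, hd, ih] at h
    rw [Equiv.Perm.sign_mul, Equiv.Perm.sign_swap hij]
    push_cast
    linear_combination h

lemma omegaTensor_eq_sum_stdTensorBasis (f : Type*) [Field f] (n : ℕ) :
    omegaTensor f n =
      ∑ σ : Equiv.Perm (Fin n), (Equiv.Perm.sign σ : ℤ) • stdTensorBasis f n n σ := by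
  simp only [omegaTensor, stdTensorBasis_apply]

lemma repr_omegaTensor_perm (f : Type*) [Field f] (n : ℕ) (σ : Equiv.Perm (Fin n)) :
    (stdTensorBasis f n n).repr (omegaTensor f n) σ = (Equiv.Perm.sign σ : ℤ) := by
  simp [omegaTensor_eq_sum_stdTensorBasis, -zsmul_eq_mul, Finsupp.single_apply, DFunLike.coe_fn_eq]

lemma repr_omegaTensor_of_not_injective (f : Type*) [Field f] {n : ℕ} {p : Fin n → Fin n}
    (hp : ¬ Function.Injective p) :
    (stdTensorBasis f n n).repr (omegaTensor f n) p = 0 := by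
  have h (σ : Equiv.Perm (Fin n)) : (σ : Fin n → Fin n) ≠ p := fun h => hp (h ▸ σ.injective)
  simp [omegaTensor_eq_sum_stdTensorBasis, -zsmul_eq_mul, h]

lemma AlternatingMap.map_eq_basis_det_smul {R M N ι : Type*} [CommRing R] [AddCommGroup M]
    [Module R M] [AddCommGroup N] [Module R N] [Fintype ι] [DecidableEq ι]
    (e : Module.Basis ι R M) (g : M [⋀^ι]→ₗ[R] N) (v : ι → M) :
    g v = e.det v • g e := by
  suffices h : g = (LinearMap.toSpanSingleton R N (g e)).compAlternatingMap e.det by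
    simpa using congrArg (fun k => k v) h
  refine Module.Basis.ext_alternating e fun i hi => ?_
  let σ : Equiv.Perm ι := Equiv.ofBijective i (Finite.injective_iff_bijective.1 hi)
  change g (e ∘ σ) = (LinearMap.toSpanSingleton R N (g e)).compAlternatingMap e.det (e ∘ σ)
  simp [AlternatingMap.map_perm, Module.Basis.det_self]

lemma tensorAct_omegaTensor (f : Type*) [Field f] (n : ℕ) (a : Matrix (Fin n) (Fin n) f) :
    tensorAct f n n a (omegaTensor f n) = a.det • omegaTensor f n := by
  let g := MultilinearMap.alternatization
    (PiTensorProduct.tprod f : MultilinearMap f (fun _ : Fin n => Fin n → f) _)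
  have hg : omegaTensor f n = g (Pi.basisFun f (Fin n)) := by
    simp [g, omegaTensor, MultilinearMap.alternatization_apply, Units.smul_def, -zsmul_eq_mul]
  have hag : tensorAct f n n a (omegaTensor f n) =
      g (a.mulVecLin ∘ Pi.basisFun f (Fin n)) := by
    simp [g, omegaTensor, MultilinearMap.alternatization_apply, Units.smul_def, -zsmul_eq_mul, tensorAct,
      PiTensorProduct.map_tprod]
  rw [hag, AlternatingMap.map_eq_basis_det_smul (Pi.basisFun f (Fin n)), ← hg,
    Module.Basis.det_comp_basis]
  congr 1
  simp [← Matrix.toLin'_apply']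

theorem invariants_span_omega (f : Type*) [Field f] [CharZero f] (n : ℕ) :
    omegaTensor f n ≠ 0 ∧
    ∀ t : ⨂[f] _ : Fin n, (Fin n → f),
      (∀ a : Matrix.SpecialLinearGroup (Fin n) f,
          tensorAct f n n (a : Matrix (Fin n) (Fin n) f) t = t) ↔
        t ∈ Submodule.span f {omegaTensor f n} := by
  refine ⟨fun h => ?_, fun t => ⟨fun ht => ?_, fun ht a => ?_⟩⟩
  · simpa [h] using repr_omegaTensor_perm f n 1
  · refine Submodule.mem_span_singleton.2 ⟨(stdTensorBasis f n n).repr t id, ?_⟩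
    refine (stdTensorBasis f n n).ext_elem fun p => ?_
    rw [map_smul, Finsupp.smul_apply, smul_eq_mul]
    by_cases hp : Function.Injective p
    · obtain ⟨σ, rfl⟩ : ∃ σ : Equiv.Perm (Fin n), ⇑σ = p :=
        ⟨Equiv.ofBijective p (Finite.injective_iff_bijective.1 hp), rfl⟩
      rw [repr_omegaTensor_perm, repr_perm_of_forall_tensorAct_eq ht, mul_comm]
    · rw [repr_omegaTensor_of_not_injective f hp, repr_eq_zero_of_not_injective ht hp, mul_zero]
  · obtain ⟨c, rfl⟩ := Submodule.mem_span_singleton.1 ht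
    rw [map_smul, tensorAct_omegaTensor, a.det_coe, one_smul]
end

section
/- The dimension of the space of SL(n,f)-invariants in V^⊗(kn) equals (kn)! · (1! 2! ⋯ (n-1)!) / (k!(k+1)! ⋯ (k+n-1)!), the number of standard Young tableaux of rectangular shape n^k. -/
open scoped TensorProduct

/-- The submodule of `SL(n,f)`-invariants in the `m`-fold tensor power of `Fin n → f`. -/
noncomputable def slInvariants (f : Type*) [Field f] (n m : ℕ) :
    Submodule f (⨂[f] _ : Fin m, (Fin n → f)) where
  carrier := {t | ∀ a : Matrix.SpecialLinearGroup (Fin n) f,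
    tensorAct f n m (a : Matrix (Fin n) (Fin n) f) t = t}
  add_mem' := by
    intro x y hx hy a
    rw [map_add, hx a, hy a]
  zero_mem' := by
    intro a
    rw [map_zero]
  smul_mem' := by
    intro c x hx a
    rw [map_smul, hx a]

/-- The number of occurrences of the letter `i` in the word `w`. -/
def letterCount {m n : ℕ} (w : Fin m → Fin n) (i : Fin n) : ℕ :=
  (Finset.univ.filter fun p => w p = i).card

theorem letterCount_eq_cons {m n : ℕ} (w : Fin (m + 1) → Fin n) (i : Fin n) :
    letterCount w i = letterCount (Fin.tail w) i + if w 0 = i then 1 else 0 := by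
  rw [letterCount, Fin.card_filter_univ_succ', add_comm]
  rfl

theorem sum_letterCount {m n : ℕ} (w : Fin m → Fin n) : ∑ i, letterCount w i = m := by
  have := Finset.card_eq_sum_card_fiberwise (f := w) (s := Finset.univ) (t := Finset.univ)
    (fun _ _ => Finset.mem_coe.2 (Finset.mem_univ _))
  simpa [letterCount] using this.symm

/-- A word is ballot if in each of its suffixes the letter counts are monotone in the letter. -/
def IsBallot {n : ℕ} : {m : ℕ} → (Fin m → Fin n) → Prop
  | 0, _ => True
  | _ + 1, w => Monotone (letterCount w) ∧ IsBallot (Fin.tail w)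

theorem IsBallot.monotone_letterCount {n : ℕ} :
    {m : ℕ} → {w : Fin m → Fin n} → IsBallot w → Monotone (letterCount w)
  | 0, _, _ => fun _ _ _ => by simp [letterCount]
  | _ + 1, _, h => h.1

theorem IsBallot.monotone_suffix {n : ℕ} {m : ℕ} {w : Fin m → Fin n} (hw : IsBallot w) (p : ℕ) :
    Monotone fun i => (Finset.univ.filter fun q : Fin m => p ≤ q ∧ w q = i).card := by
  induction m generalizing p with
  | zero => intro i j _; simp
  | succ m ih =>
    cases p with
    | zero => simpa [letterCount] using! hw.1
    | succ p =>
      simpa [Fin.card_filter_univ_succ', Fin.tail] using! ih hw.2 p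

open Classical in
/-- The ballot words of length `m` with letter counts `l`. -/
noncomputable def ballotWords (m n : ℕ) (l : Fin n → ℕ) : Finset (Fin m → Fin n) :=
  Finset.univ.filter fun w => IsBallot w ∧ letterCount w = l

theorem ballotWords_eq_empty {m n : ℕ} {l : Fin n → ℕ} (hl : ¬ Monotone l) :
    ballotWords m n l = ∅ := by
  classical
  refine Finset.filter_eq_empty_iff.2 fun w _ h => hl ?_
  rw [← h.2]
  exact h.1.monotone_letterCount

theorem letterCount_cons_eq_iff {m n : ℕ} (w : Fin m → Fin n) (i : Fin n) (l : Fin n → ℕ) :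
    letterCount (Fin.cons i w : Fin (m + 1) → Fin n) = l ↔
      0 < l i ∧ letterCount w = l - Pi.single i 1 := by
  constructor
  · rintro rfl
    refine ⟨by simp [letterCount_eq_cons], ?_⟩
    ext j
    rcases eq_or_ne i j with rfl | h
    · simp [letterCount_eq_cons]
    · simp [letterCount_eq_cons, h]
  · rintro ⟨h0, h⟩
    ext j
    rcases eq_or_ne i j with rfl | hij
    · simp [letterCount_eq_cons, h]; omega
    · simp [letterCount_eq_cons, h, hij]

theorem card_ballotWords_succ {m n : ℕ} {l : Fin n → ℕ} (hl : Monotone l) :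
    (ballotWords (m + 1) n l).card =
      ∑ i, if 0 < l i then (ballotWords m n (l - Pi.single i 1)).card else 0 := by
  classical
  rw [Finset.card_eq_sum_card_fiberwise (f := fun w => w 0) (t := Finset.univ)
    (fun _ _ => Finset.mem_coe.2 (Finset.mem_univ _))]
  refine Finset.sum_congr rfl fun i _ => ?_
  split_ifs with hi
  · symm
    refine Finset.card_bij (fun w _ => Fin.cons i w) ?_ ?_ ?_
    · intro w hw
      simp only [ballotWords, Finset.mem_filter, Finset.mem_univ, true_and] at hw ⊢
      have := (letterCount_cons_eq_iff w i l).2 ⟨hi, hw.2⟩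
      exact ⟨⟨⟨this ▸ hl, hw.1⟩, this⟩, rfl⟩
    · intro w _ w' _ h
      exact (Fin.cons_injective2 h).2
    · intro w hw
      simp only [ballotWords, Finset.mem_filter, Finset.mem_univ, true_and] at hw
      obtain ⟨⟨h1, h2⟩, rfl⟩ := hw
      refine ⟨Fin.tail w, ?_, Fin.cons_self_tail w⟩
      simp only [ballotWords, Finset.mem_filter, Finset.mem_univ, true_and]
      refine ⟨h1.2, ((letterCount_cons_eq_iff _ _ l).1 ?_).2⟩
      rwa [Fin.cons_self_tail]
  · rw [Finset.card_eq_zero, Finset.filter_eq_empty_iff]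
    intro w hw h
    simp only [ballotWords, Finset.mem_filter, Finset.mem_univ, true_and] at hw
    refine hi ((letterCount_cons_eq_iff (Fin.tail w) i l).1 ?_).1
    rw [← h, Fin.cons_self_tail]
    exact hw.2

/-- The Vandermonde determinant in the basis of falling factorials. -/
noncomputable def fallingDet {n : ℕ} (x : Fin n → ℤ) : ℤ :=
  (Matrix.of fun i j : Fin n => (descPochhammer ℤ j).eval (x i)).det

theorem fallingDet_eq_vandermonde {n : ℕ} (x : Fin n → ℤ) :
    fallingDet x = (Matrix.vandermonde x).det :=
  (Matrix.det_eval_matrixOfPolynomials_eq_det_vandermonde x (fun i => descPochhammer ℤ i)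
    (fun i => descPochhammer_natDegree ℤ i) (fun i => monic_descPochhammer ℤ i)).symm

theorem fallingDet_eq_zero {n : ℕ} {x : Fin n → ℤ} {i j : Fin n} (hij : i ≠ j) (h : x i = x j) :
    fallingDet x = 0 :=
  Matrix.det_zero_of_row_eq hij (by ext; simp [h])

theorem mul_descPochhammer_eval_sub_one (j : ℕ) (x : ℤ) :
    x * (descPochhammer ℤ j).eval (x - 1) = (x - j) * (descPochhammer ℤ j).eval x := by
  have := descPochhammer_succ_eval j x
  rw [descPochhammer_succ_left] at this
  simp only [Polynomial.eval_mul, Polynomial.eval_X, Polynomial.eval_comp, Polynomial.eval_sub,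
    Polynomial.eval_one] at this
  rw [this, mul_comm]

theorem sum_mul_fallingDet_sub_single {n : ℕ} (x : Fin n → ℤ) :
    ∑ i, x i * fallingDet (x - Pi.single i 1) = (∑ i, (x i - (i : ℕ))) * fallingDet x := by
  have key (i : Fin n) (σ : Equiv.Perm (Fin n)) :
      x i * ∏ a, (descPochhammer ℤ (σ a : ℕ)).eval ((x - Pi.single i 1 : Fin n → ℤ) a) =
        (x i - (σ i : ℕ)) * ∏ a, (descPochhammer ℤ (σ a : ℕ)).eval (x a) := by
    rw [← Finset.mul_prod_erase _ _ (Finset.mem_univ i),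
      ← Finset.mul_prod_erase _ (fun a => (descPochhammer ℤ (σ a : ℕ)).eval (x a))
        (Finset.mem_univ i), ← mul_assoc, ← mul_assoc]
    congr 1
    · simpa using mul_descPochhammer_eval_sub_one (σ i) (x i)
    · refine Finset.prod_congr rfl fun a ha => ?_
      simp [Pi.single_eq_of_ne (Finset.ne_of_mem_erase ha)]
  have hs (σ : Equiv.Perm (Fin n)) : ∑ i, (x i - ((σ i : Fin n) : ℕ)) =
      ∑ i, (x i - ((i : ℕ) : ℤ)) := by
    rw [Finset.sum_sub_distrib, Finset.sum_sub_distrib,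
      Equiv.sum_comp σ fun i : Fin n => ((i : ℕ) : ℤ)]
  simp only [fallingDet, ← Matrix.det_transpose (Matrix.of _), Matrix.det_apply',
    Matrix.transpose_apply, Matrix.of_apply, Finset.mul_sum]
  rw [Finset.sum_comm]
  refine Finset.sum_congr rfl fun σ _ => ?_
  simp only [mul_left_comm (x _), key]
  rw [← Finset.mul_sum, ← Finset.sum_mul, hs σ]
  ring

theorem card_ballotWords_mul {m n : ℕ} (l : Fin n → ℕ) (hl : Monotone l) (hs : ∑ i, l i = m) :
    ((ballotWords m n l).card : ℤ) * ∏ i, ((l i + i).factorial : ℤ) =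
      m.factorial * fallingDet fun i => (l i + i : ℤ) := by
  induction m generalizing l with
  | zero =>
    have h0 : l = 0 := by
      ext i
      simpa using (Finset.sum_eq_zero_iff.1 hs) i (Finset.mem_univ i)
    subst h0
    have hc : (ballotWords 0 n 0).card = 1 := by
      classical
      rw [ballotWords, Finset.filter_true_of_mem]
      · simp
      · intro w _
        refine ⟨trivial, ?_⟩
        ext i
        simp [letterCount]
    rw [hc]
    simp only [fallingDet_eq_vandermonde]
    cases n with
    | zero => simp
    | succ n =>
      simp [Matrix.det_vandermonde_id_eq_superFactorial,
        ← Nat.prod_range_succ_factorial, Finset.prod_range]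
  | succ m ih =>
    have hsum : (∑ i, ((l i + (i : ℕ) : ℤ) - (i : ℕ))) = m + 1 := by
      simp only [add_sub_cancel_right]
      exact_mod_cast hs
    rw [card_ballotWords_succ hl, Nat.factorial_succ]
    push_cast
    rw [mul_comm ((m : ℤ) + 1), mul_assoc, ← hsum, ← sum_mul_fallingDet_sub_single,
      Finset.sum_mul, Finset.mul_sum]
    refine Finset.sum_congr rfl fun i _ => ?_
    by_cases hm : 0 < l i ∧ Monotone (l - Pi.single i 1)
    · obtain ⟨hi, hm⟩ := hm
      have hadd : l - Pi.single i 1 + Pi.single i 1 = l := by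
        ext j
        rcases eq_or_ne i j with rfl | hij
        · simp; omega
        · simp [Pi.single_eq_of_ne' hij]
      have hsm : ∑ j, (l - Pi.single i 1 : Fin n → ℕ) j = m := by
        have : ∑ j, (l - Pi.single i 1 + Pi.single i 1 : Fin n → ℕ) j = m + 1 := by rw [hadd, hs]
        simpa [Finset.sum_add_distrib] using this
      have h := ih _ hm hsm
      have harg : (fun j => (((l - Pi.single i 1 : Fin n → ℕ) j : ℕ) + (j : ℕ) : ℤ)) =
          (fun j => (l j + (j : ℕ) : ℤ)) - Pi.single i 1 := by
        ext j
        rcases eq_or_ne i j with rfl | hij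
        · simp [Nat.cast_sub hi]; ring
        · simp [Pi.single_eq_of_ne' hij]
      have hfac : ∏ j, ((l j + j).factorial : ℤ) =
          (l i + i) * ∏ j, (((l - Pi.single i 1 : Fin n → ℕ) j + j).factorial : ℤ) := by
        generalize hl' : (l - Pi.single i 1 : Fin n → ℕ) = l'
        have hi' : l i = l' i + 1 := by
          rw [← hl', Pi.sub_apply, Pi.single_eq_same]
          omega
        rw [← Finset.mul_prod_erase _ _ (Finset.mem_univ i),
          ← Finset.mul_prod_erase _ (fun j => ((l' j + j).factorial : ℤ)) (Finset.mem_univ i),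
          ← mul_assoc]
        congr 1
        · rw [hi', add_right_comm, Nat.factorial_succ]
          push_cast
          ring
        · refine Finset.prod_congr rfl fun j hj => ?_
          simp [← hl', Pi.single_eq_of_ne (Finset.ne_of_mem_erase hj)]
      rw [if_pos hi, hfac, ← harg, mul_left_comm, h]
      ring
    · have hz : (l i + (i : ℕ) : ℤ) *
          fallingDet ((fun j => (l j + (j : ℕ) : ℤ)) - Pi.single i 1) = 0 := by
        by_cases h0 : (i : ℕ) = 0 ∧ l i = 0
        · simp [h0]
        refine mul_eq_zero_of_right _ ?_
        have hi0 : (i : ℕ) ≠ 0 := by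
          intro h
          refine hm ⟨by omega, fun a b hab => ?_⟩
          have := hl hab
          rcases eq_or_ne i b with rfl | hb
          · have : a = i := by omega
            simp [this]
          · simp only [Pi.sub_apply, Pi.single_eq_of_ne' hb]
            omega
        let i' : Fin n := ⟨i - 1, by omega⟩
        have hne : i' ≠ i := by simp only [i', ne_eq, Fin.ext_iff]; omega
        have hle : i' ≤ i := by simp [i', Fin.le_def]
        have hl' : l i' = l i := by
          refine le_antisymm (hl hle) ?_
          by_contra! hlt
          refine hm ⟨by omega, fun a b hab => ?_⟩
          have hab' := hl hab
          rcases eq_or_ne i b with rfl | hb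
          · rcases eq_or_ne i a with rfl | ha
            · rfl
            · have : l a ≤ l i' := hl (by simp only [i', Fin.le_def] at hab ⊢; omega)
              simp only [Pi.sub_apply, Pi.single_eq_same, Pi.single_eq_of_ne' ha]
              omega
          · simp only [Pi.sub_apply, Pi.single_eq_of_ne' hb]
            omega
        refine fallingDet_eq_zero hne ?_
        have : ((i' : ℕ) : ℤ) = (i : ℕ) - 1 := by simp only [i']; omega
        simp [Pi.single_eq_of_ne hne, hl', this]
        ring
      rw [hz, mul_zero]
      by_cases hi : 0 < l i
      · rw [if_pos hi, ballotWords_eq_empty fun h => hm ⟨hi, h⟩]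
        simp
      · simp [hi]

theorem card_ballotWords_const_mul (n k : ℕ) :
    (ballotWords (k * n) n fun _ => k).card * ∏ i ∈ Finset.range n, Nat.factorial (k + i) =
      Nat.factorial (k * n) * ∏ i ∈ Finset.range n, Nat.factorial i := by
  have h := card_ballotWords_mul (m := k * n) (n := n) (fun _ => k) monotone_const
    (by simp [mul_comm])
  have hd : fallingDet (fun i : Fin n => ((k : ℤ) + (i : ℕ))) =
      ((∏ i ∈ Finset.range n, Nat.factorial i : ℕ) : ℤ) := by
    rw [fallingDet_eq_vandermonde]
    cases n with
    | zero => simp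
    | succ n =>
      rw [Nat.prod_range_succ_factorial, ← Matrix.det_vandermonde_id_eq_superFactorial,
        ← Matrix.det_vandermonde_add (fun i : Fin (n + 1) => ((i : ℕ) : ℤ)) (k : ℤ)]
      simp only [add_comm]
  rw [hd] at h
  rw [Finset.prod_range]
  exact_mod_cast h

section Derivation

variable {f : Type*} [Field f] {m n : ℕ}

/-- The action of the matrix `X` on the `p`-th tensor factor, on functions of words. -/
def siteAct (X : Matrix (Fin n) (Fin n) f) (p : Fin m) :
    Module.End f ((Fin m → Fin n) → f) where
  toFun t w := ∑ j, X (w p) j * t (Function.update w p j)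
  map_add' s t := by
    ext w
    simp [mul_add, Finset.sum_add_distrib]
  map_smul' c t := by
    ext w
    simp [Finset.mul_sum, mul_left_comm]

theorem siteAct_apply (X : Matrix (Fin n) (Fin n) f) (p : Fin m) (t : (Fin m → Fin n) → f)
    (w : Fin m → Fin n) :
    siteAct X p t w = ∑ j, X (w p) j * t (Function.update w p j) :=
  rfl

theorem siteAct_mul_self (X Y : Matrix (Fin n) (Fin n) f) (p : Fin m) :
    siteAct X p * siteAct Y p = siteAct (X * Y) p := by
  refine LinearMap.ext fun t => funext fun w => ?_
  simp only [Module.End.mul_apply, siteAct_apply, Function.update_self, Function.update_idem,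
    Matrix.mul_apply, Finset.mul_sum, Finset.sum_mul]
  rw [Finset.sum_comm]
  simp only [mul_assoc]

theorem siteAct_mul_comm (X Y : Matrix (Fin n) (Fin n) f) {p q : Fin m} (h : p ≠ q) :
    siteAct X p * siteAct Y q = siteAct Y q * siteAct X p := by
  refine LinearMap.ext fun t => funext fun w => ?_
  simp only [Module.End.mul_apply, siteAct_apply, Function.update_of_ne h,
    Function.update_of_ne h.symm, Finset.mul_sum]
  rw [Finset.sum_comm]
  simp only [Function.update_comm h, mul_left_comm]

/-- The derivation action of the matrix `X` on functions of words. -/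
def derivAct (X : Matrix (Fin n) (Fin n) f) : Module.End f ((Fin m → Fin n) → f) :=
  ∑ p, siteAct X p

theorem derivAct_apply (X : Matrix (Fin n) (Fin n) f) (t : (Fin m → Fin n) → f)
    (w : Fin m → Fin n) :
    derivAct X t w = ∑ p, ∑ j, X (w p) j * t (Function.update w p j) := by
  simp [derivAct, LinearMap.sum_apply, Finset.sum_apply, siteAct_apply]

theorem derivAct_mul_sub_mul (X Y : Matrix (Fin n) (Fin n) f) :
    derivAct X * derivAct Y - derivAct Y * derivAct X =
      (derivAct (X * Y - Y * X) : Module.End f ((Fin m → Fin n) → f)) := by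
  have hsub (p : Fin m) : siteAct (X * Y - Y * X) p = siteAct (X * Y) p - siteAct (Y * X) p := by
    refine LinearMap.ext fun t => funext fun w => ?_
    simp [siteAct_apply, sub_mul, Finset.sum_sub_distrib]
  simp only [derivAct, Finset.sum_mul_sum, hsub]
  rw [Finset.sum_comm (f := fun p q : Fin m => siteAct Y p * siteAct X q),
    ← Finset.sum_sub_distrib]
  refine Finset.sum_congr rfl fun p _ => ?_
  rw [← Finset.sum_sub_distrib, Finset.sum_eq_single p]
  · rw [siteAct_mul_self, siteAct_mul_self]
  · intro q _ hq
    rw [siteAct_mul_comm X Y hq.symm, sub_self]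
  · simp

theorem derivAct_cons (X : Matrix (Fin n) (Fin n) f) (t : (Fin (m + 1) → Fin n) → f)
    (i : Fin n) (w : Fin m → Fin n) :
    derivAct X t (Fin.cons i w) =
      ∑ j, X i j * t (Fin.cons j w) + derivAct X (fun v => t (Fin.cons i v)) w := by
  simp only [derivAct_apply, Fin.sum_univ_succ, Fin.cons_zero, Fin.cons_succ,
    Fin.update_cons_zero, Fin.cons_update]

theorem derivAct_single_apply {a b : Fin n} (t : (Fin m → Fin n) → f) (w : Fin m → Fin n) :
    derivAct (Matrix.single b a 1) t w =
      ∑ p, if w p = b then t (Function.update w p a) else 0 := by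
  rw [derivAct_apply]
  refine Finset.sum_congr rfl fun p _ => ?_
  rw [Finset.sum_eq_single a]
  · simp [Matrix.single_apply, eq_comm]
  · intro j _ hj
    simp [hj.symm]
  · simp

theorem derivAct_diagonal_apply (d : Fin n → f) (t : (Fin m → Fin n) → f) (w : Fin m → Fin n) :
    derivAct (Matrix.diagonal d) t w = (∑ i, letterCount w i * d i) * t w := by
  have hs : ∑ i, (letterCount w i : f) * d i = ∑ p, d (w p) := by
    simp only [letterCount, Finset.card_filter, Nat.cast_sum, Finset.sum_mul]
    rw [Finset.sum_comm]
    simp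
  rw [derivAct_apply, hs, Finset.sum_mul]
  refine Finset.sum_congr rfl fun p _ => ?_
  rw [Finset.sum_eq_single (w p)]
  · simp
  · intro j _ hj
    simp [Matrix.diagonal_apply_ne' _ hj]
  · simp

variable [CharZero f]

theorem letterCount_le_of_derivAct_eq_zero {t : (Fin m → Fin n) → f} (ht : t ≠ 0)
    {l : Fin n → ℕ} (hl : ∀ w, t w ≠ 0 → letterCount w = l) {a b : Fin n} (hab : a ≠ b)
    (h0 : derivAct (Matrix.single b a 1) t = 0) : l a ≤ l b := by
  by_contra! hlt
  let H : Module.End f ((Fin m → Fin n) → f) :=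
    derivAct (Matrix.diagonal (Pi.single b 1 - Pi.single a 1))
  have hH : H t = ((l b : f) - l a) • t := by
    ext w
    by_cases hw : t w = 0
    · simp [H, derivAct_diagonal_apply, hw]
    · simp [H, derivAct_diagonal_apply, hl w hw, mul_sub, Finset.sum_sub_distrib, Pi.single_apply]
  have hne : (l b : f) - l a ≠ 0 := by
    rw [sub_ne_zero, Ne, Nat.cast_inj]
    omega
  have hmat : Matrix.diagonal (Pi.single b 1 - Pi.single a 1) =
      Matrix.single b b (1 : f) - Matrix.single a a 1 := by
    ext i j
    by_cases hij : i = j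
    · subst hij
      simp [Matrix.single_apply, Pi.single_apply, eq_comm]
    · simp only [Matrix.diagonal_apply_ne _ hij, Matrix.sub_apply, Matrix.single_apply]
      rw [if_neg (by rintro ⟨rfl, rfl⟩; exact hij rfl),
        if_neg (by rintro ⟨rfl, rfl⟩; exact hij rfl), sub_zero]
  have hnsmul (X : Matrix (Fin n) (Fin n) f) :
      (derivAct (2 • X) : Module.End f ((Fin m → Fin n) → f)) = 2 • derivAct X := by
    refine LinearMap.ext fun t => funext fun w => ?_
    simp [derivAct_apply, two_smul, add_mul, Finset.sum_add_distrib]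
  have hneg (X : Matrix (Fin n) (Fin n) f) :
      (derivAct (-X) : Module.End f ((Fin m → Fin n) → f)) = -derivAct X := by
    refine LinearMap.ext fun t => funext fun w => ?_
    simp [derivAct_apply]
  let _ : LieRing (Module.End f ((Fin m → Fin n) → f)) := LieRing.ofAssociativeRing
  have triple : IsSl2Triple H (derivAct (Matrix.single b a 1)) (derivAct (Matrix.single a b 1)) :=
    { h_ne_zero := fun h => smul_ne_zero hne ht (by rw [← hH, h, LinearMap.zero_apply])
      lie_e_f := by
        refine (derivAct_mul_sub_mul _ _).trans ?_
        simp [H, hmat]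
      lie_h_e_nsmul := by
        refine (derivAct_mul_sub_mul _ _).trans ?_
        rw [hmat, ← hnsmul]
        congr 1
        simp [sub_mul, mul_sub, hab, two_smul]
      lie_h_f_nsmul := by
        refine (derivAct_mul_sub_mul _ _).trans ?_
        rw [hmat, ← hnsmul, ← hneg]
        congr 1
        rw [sub_mul, mul_sub]
        simp [hab.symm, two_smul, sub_eq_add_neg] }
  have prim : triple.HasPrimitiveVectorWith t ((l b : f) - l a) := ⟨ht, hH, h0⟩
  obtain ⟨N, hN⟩ := prim.exists_nat
  have : (l b : f) = ((N + l a : ℕ) : f) := by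
    push_cast
    rw [← hN, sub_add_cancel]
  have := Nat.cast_injective this
  omega

theorem exists_isBallot_of_derivAct_eq_zero {t : (Fin m → Fin n) → f} (ht : t ≠ 0)
    {l : Fin n → ℕ} (hl : ∀ w, t w ≠ 0 → letterCount w = l)
    (h0 : ∀ a b : Fin n, a < b → derivAct (Matrix.single b a 1) t = 0) :
    ∃ w, IsBallot w ∧ t w ≠ 0 := by
  induction m generalizing l with
  | zero =>
    obtain ⟨w, hw⟩ := Function.ne_iff.1 ht
    exact ⟨w, trivial, hw⟩
  | succ m ih =>
    have hmono : Monotone l := fun a b hab => by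
      rcases hab.eq_or_lt with rfl | hlt
      · rfl
      · exact letterCount_le_of_derivAct_eq_zero ht hl hlt.ne (h0 a b hlt)
    have hex : ∃ i : Fin n, (fun v => t (Fin.cons i v)) ≠ 0 := by
      obtain ⟨w, hw⟩ := Function.ne_iff.1 ht
      refine ⟨w 0, Function.ne_iff.2 ⟨Fin.tail w, ?_⟩⟩
      rwa [Fin.cons_self_tail]
    obtain ⟨i, hi, hmin⟩ := WellFounded.has_min (wellFounded_lt (α := Fin n))
      {i | (fun v => t (Fin.cons i v)) ≠ 0} hex
    have hlow (a : Fin n) (ha : a < i) (v : Fin m → Fin n) : t (Fin.cons a v) = 0 := by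
      by_contra h
      exact hmin a (fun h' => h (congrFun h' v)) ha
    obtain ⟨w, hw, htw⟩ := ih hi (l := l - Pi.single i 1)
      (fun w hw => ((letterCount_cons_eq_iff w i l).1 (hl _ hw)).2) (fun a b hab => by
        ext w
        have h := congrFun (h0 a b hab) (Fin.cons i w)
        rw [derivAct_cons, Finset.sum_eq_zero, zero_add] at h
        · exact h
        · intro j _
          by_cases hj : b = i ∧ a = j
          · rw [← hj.2, hlow a (hj.1 ▸ hab), mul_zero]
          · rw [Matrix.single_apply, if_neg hj, zero_mul])
    refine ⟨Fin.cons i w, ⟨?_, ?_⟩, htw⟩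
    · rw [hl _ htw]
      exact hmono
    · rwa [Fin.tail_cons]

end Derivation

section WordAct

variable {f : Type*} [Field f] {m n : ℕ}

/-- The diagonal action of a matrix on functions of words. -/
def wordAct (a : Matrix (Fin n) (Fin n) f) (t : (Fin m → Fin n) → f) (w : Fin m → Fin n) : f :=
  ∑ u : Fin m → Fin n, (∏ p, a (w p) (u p)) * t u

theorem prod_ite_eq_eq_ite {m n : ℕ} {R : Type*} [CommSemiring R] (w u : Fin m → Fin n)
    (s : Finset (Fin m)) :
    (∏ p ∈ s, if w p = u p then (1 : R) else 0) = if ∀ p ∈ s, w p = u p then 1 else 0 := by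
  rw [Finset.prod_ite_zero]
  simp

theorem wordAct_diagonal (d : Fin n → f) (t : (Fin m → Fin n) → f) (w : Fin m → Fin n) :
    wordAct (Matrix.diagonal d) t w = (∏ i, d i ^ letterCount w i) * t w := by
  have hs : ∏ i, d i ^ letterCount w i = ∏ p, d (w p) := by
    rw [← Finset.prod_fiberwise_of_maps_to (g := w) (t := Finset.univ) fun _ _ => Finset.mem_univ _]
    refine Finset.prod_congr rfl fun i _ => ?_
    rw [Finset.prod_congr rfl fun p hp => congrArg d (Finset.mem_filter.1 hp).2,
      Finset.prod_const, letterCount]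
  rw [wordAct, hs, Finset.sum_eq_single w]
  · simp
  · intro u _ hu
    obtain ⟨p, hp⟩ := Function.ne_iff.1 hu
    rw [Finset.prod_eq_zero (Finset.mem_univ p), zero_mul]
    exact Matrix.diagonal_apply_ne' _ hp
  · simp

variable [CharZero f] {t : (Fin m → Fin n) → f}

theorem derivAct_single_eq_zero_of_invariant
    (ht : ∀ a : Matrix (Fin n) (Fin n) f, a.det = 1 → wordAct a t = t) {a b : Fin n}
    (hab : a < b) : derivAct (Matrix.single b a 1) t = 0 := by
  ext w
  let P : Polynomial f := ∑ u : Fin m → Fin n,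
    (∏ p, (Polynomial.C ((1 : Matrix (Fin n) (Fin n) f) (w p) (u p)) +
      Polynomial.X * Polynomial.C (Matrix.single b a (1 : f) (w p) (u p)))) * Polynomial.C (t u)
  have hP : P = Polynomial.C (t w) := by
    refine Polynomial.funext fun c => ?_
    have h := congrFun (ht (Matrix.transvection b a c)
      (Matrix.det_transvection_of_ne _ _ hab.ne' c)) w
    rw [Polynomial.eval_C, ← h]
    simp only [P, wordAct, Polynomial.eval_finsetSum, Polynomial.eval_mul, Polynomial.eval_prod,
      Polynomial.eval_add, Polynomial.eval_C, Polynomial.eval_X, Matrix.transvection,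
      Matrix.add_apply, Matrix.single_apply, mul_ite, mul_one, mul_zero]
  have hd : Polynomial.eval 0 (Polynomial.derivative P) = 0 := by
    rw [hP, Polynomial.derivative_C, Polynomial.eval_zero]
  rw [Pi.zero_apply, ← hd, derivAct_single_apply]
  simp only [P, Polynomial.derivative_sum, Polynomial.derivative_mul, Polynomial.derivative_C,
    mul_zero, add_zero, Polynomial.derivative_prod_finset, Polynomial.derivative_add,
    Polynomial.derivative_X, zero_add, one_mul, Polynomial.eval_finsetSum, Polynomial.eval_mul,
    Polynomial.eval_prod, Polynomial.eval_add, Polynomial.eval_C, Polynomial.eval_X, zero_mul,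
    Finset.sum_mul]
  rw [Finset.sum_comm]
  refine Finset.sum_congr rfl fun p _ => ?_
  simp only [Matrix.one_apply, prod_ite_eq_eq_ite]
  rw [Finset.sum_eq_single (Function.update w p a)]
  · have h : ∀ q ∈ Finset.univ.erase p, w q = Function.update w p a q := fun q hq => by
      rw [Function.update_of_ne (Finset.ne_of_mem_erase hq)]
    rw [if_pos h]
    simp [Matrix.single_apply, eq_comm]
  · intro u _ hu
    by_cases h : ∀ q ∈ Finset.univ.erase p, w q = u q
    · have hp : u p ≠ a := by
        rintro rfl
        refine hu (funext fun q => ?_)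
        by_cases hq : q = p
        · subst hq; simp
        · rw [Function.update_of_ne hq, h q (by simp [hq])]
      simp [hp.symm]
    · rw [if_neg h, zero_mul, zero_mul]
  · simp

theorem letterCount_eq_of_invariant
    (ht : ∀ a : Matrix (Fin n) (Fin n) f, a.det = 1 → wordAct a t = t)
    {w : Fin m → Fin n} (hw : t w ≠ 0) (i j : Fin n) : letterCount w i = letterCount w j := by
  rcases eq_or_ne i j with rfl | hij
  · rfl
  let d : Fin n → f := Function.update (Function.update 1 j 2⁻¹) i 2
  have hprod (c : Fin n → ℕ) : ∏ l, d l ^ c l = 2 ^ c i * 2⁻¹ ^ c j := by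
    rw [Fintype.prod_eq_mul i j hij]
    · simp [d, Function.update_of_ne hij.symm]
    · intro l hl
      simp [d, Function.update_of_ne hl.1, Function.update_of_ne hl.2]
  have hdet : (Matrix.diagonal d).det = 1 := by
    have := hprod fun _ => 1
    rw [Matrix.det_diagonal]
    simpa using this
  have h := congrFun (ht _ hdet) w
  rw [wordAct_diagonal, hprod, mul_eq_right₀ hw, inv_pow,
    mul_inv_eq_one₀ (pow_ne_zero _ two_ne_zero)] at h
  have h' : (2 : ℕ) ^ letterCount w i = 2 ^ letterCount w j := by exact_mod_cast h
  exact Nat.pow_right_injective le_rfl h'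

theorem letterCount_eq_const_of_invariant {k : ℕ} {t : (Fin (k * n) → Fin n) → f}
    (ht : ∀ a : Matrix (Fin n) (Fin n) f, a.det = 1 → wordAct a t = t)
    {w : Fin (k * n) → Fin n} (hw : t w ≠ 0) : letterCount w = fun _ => k := by
  ext i
  have h := sum_letterCount w
  rw [Finset.sum_congr rfl fun j _ => letterCount_eq_of_invariant ht hw j i] at h
  simp only [Finset.sum_const, Finset.card_univ, Fintype.card_fin, smul_eq_mul] at h
  rw [mul_comm] at h
  exact Nat.eq_of_mul_eq_mul_right i.pos h

theorem exists_mem_ballotWords_of_invariant {k : ℕ} {t : (Fin (k * n) → Fin n) → f}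
    (ht : ∀ a : Matrix (Fin n) (Fin n) f, a.det = 1 → wordAct a t = t) (h0 : t ≠ 0) :
    ∃ w ∈ ballotWords (k * n) n fun _ => k, t w ≠ 0 := by
  obtain ⟨w, hw, htw⟩ := exists_isBallot_of_derivAct_eq_zero h0
    (fun w hw => letterCount_eq_const_of_invariant ht hw)
    fun a b hab => derivAct_single_eq_zero_of_invariant ht hab
  refine ⟨w, ?_, htw⟩
  simp only [ballotWords, Finset.mem_filter, Finset.mem_univ, true_and]
  exact ⟨hw, letterCount_eq_const_of_invariant ht htw⟩

end WordAct

section Polytabloid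

variable {f : Type*} [Field f] {m n k : ℕ}

theorem sum_prod_mul_det_submatrix_one (M : Matrix (Fin n) (Fin n) f) :
    ∑ v : Fin n → Fin n,
      (∏ r, M r (v r)) * ((1 : Matrix (Fin n) (Fin n) f).submatrix v id).det = M.det := by
  have hM : M = fun r => ∑ s, M r s • (1 : Matrix (Fin n) (Fin n) f) s := by
    ext r s
    simp [Matrix.one_apply]
  conv_rhs => rw [hM]
  refine Eq.trans ?_ ((Matrix.detRowAlternating (R := f) (n := Fin n)).toMultilinearMap.map_sum
    fun r s => M r s • (1 : Matrix (Fin n) (Fin n) f) s).symm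
  refine Finset.sum_congr rfl fun v _ => ?_
  rw [MultilinearMap.map_smul_univ, smul_eq_mul]
  rfl

/-- The product over the columns `c` of a rectangular tableau `e` of the determinants formed by the
letters of a word in column `c`. -/
def polytabloid (f : Type*) [Field f] (e : Fin m ≃ Fin k × Fin n) (u : Fin m → Fin n) : f :=
  ∏ c, ((1 : Matrix (Fin n) (Fin n) f).submatrix (fun r => u (e.symm (c, r))) id).det

theorem wordAct_polytabloid (e : Fin m ≃ Fin k × Fin n) {a : Matrix (Fin n) (Fin n) f}
    (ha : a.det = 1) : wordAct a (polytabloid f e) = polytabloid f e := by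
  ext w
  let E : (Fin m → Fin n) ≃ (Fin k → Fin n → Fin n) :=
    (Equiv.arrowCongr e (Equiv.refl _)).trans (Equiv.curry _ _ _)
  have hterm (u : Fin m → Fin n) : (∏ p, a (w p) (u p)) * polytabloid f e u =
      ∏ c, ((∏ r, a (w (e.symm (c, r))) (E u c r)) *
        ((1 : Matrix (Fin n) (Fin n) f).submatrix (E u c) id).det) := by
    rw [Finset.prod_mul_distrib, ← Fintype.prod_prod_type', ← Equiv.prod_comp e.symm]
    rfl
  have hcol (c : Fin k) : ∑ v : Fin n → Fin n, (∏ r, a (w (e.symm (c, r))) (v r)) *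
      ((1 : Matrix (Fin n) (Fin n) f).submatrix v id).det =
      ((1 : Matrix (Fin n) (Fin n) f).submatrix (fun r => w (e.symm (c, r))) id).det := by
    have h := sum_prod_mul_det_submatrix_one (a.submatrix (fun r => w (e.symm (c, r))) id)
    simp only [Matrix.submatrix_apply, id] at h
    rw [h]
    have hmul : a.submatrix (fun r => w (e.symm (c, r))) id =
        (1 : Matrix (Fin n) (Fin n) f).submatrix (fun r => w (e.symm (c, r))) id * a := by
      ext r s
      simp [Matrix.mul_apply, Matrix.one_apply]
    rw [hmul, Matrix.det_mul, ha, mul_one]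
  simp only [wordAct, hterm]
  rw [Equiv.sum_comp E fun v => ∏ c, ((∏ r, a (w (e.symm (c, r))) (v c r)) *
        ((1 : Matrix (Fin n) (Fin n) f).submatrix (v c) id).det)]
  rw [← Fintype.prod_sum fun c v => (∏ r, a (w (e.symm (c, r))) (v r)) *
        ((1 : Matrix (Fin n) (Fin n) f).submatrix v id).det]
  exact Finset.prod_congr rfl fun c _ => hcol c

theorem polytabloid_self (e : Fin m ≃ Fin k × Fin n) :
    polytabloid f e (fun p => (e p).2) = 1 := by
  refine Finset.prod_eq_one fun c _ => ?_
  simp only [Equiv.apply_symm_apply]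
  exact Matrix.det_one

theorem injective_of_polytabloid_ne_zero {e : Fin m ≃ Fin k × Fin n} {u : Fin m → Fin n}
    (hu : polytabloid f e u ≠ 0) (c : Fin k) :
    Function.Injective fun r => u (e.symm (c, r)) := by
  intro r s hrs
  by_contra hne
  refine Finset.prod_ne_zero_iff.1 hu c (Finset.mem_univ c) (Matrix.det_zero_of_row_eq hne ?_)
  ext j
  exact congrFun (congrArg (1 : Matrix (Fin n) (Fin n) f) hrs) j

/-- The number of letters `≥ j` in the suffix of `w` starting at position `p`. -/
def suffixCount (w : Fin m → Fin n) (p j : ℕ) : ℕ :=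
  (Finset.univ.filter fun q : Fin m => p ≤ q ∧ j ≤ w q).card

theorem suffixCount_eq_sum (e : Fin m ≃ Fin k × Fin n) (w : Fin m → Fin n) (p j : ℕ) :
    suffixCount w p j = ∑ c, (Finset.univ.filter fun r : Fin n =>
      p ≤ (e.symm (c, r) : ℕ) ∧ j ≤ (w (e.symm (c, r)) : ℕ)).card := by
  simp only [suffixCount, Finset.card_filter]
  rw [← Fintype.sum_prod_type', ← Equiv.sum_comp e.symm]

theorem suffixCount_injective {u w : Fin m → Fin n}
    (h : ∀ p < m, ∀ j < n, suffixCount u p j = suffixCount w p j) : u = w := by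
  have hm (v : Fin m → Fin n) (j : ℕ) : suffixCount v m j = 0 := by
    rw [suffixCount, Finset.card_eq_zero, Finset.filter_eq_empty_iff]
    intro q _ hq
    omega
  have hstep (v : Fin m → Fin n) (p : Fin m) (j : ℕ) :
      suffixCount v p j = suffixCount v (p + 1) j + if j ≤ v p then 1 else 0 := by
    have hp : (if j ≤ (v p : ℕ) then 1 else 0) =
        ∑ q : Fin m, if p = q then (if j ≤ (v q : ℕ) then 1 else 0) else 0 := by simp
    rw [hp, suffixCount, suffixCount, Finset.card_filter, Finset.card_filter,
      ← Finset.sum_add_distrib]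
    refine Finset.sum_congr rfl fun q _ => ?_
    rcases lt_trichotomy p q with hpq | rfl | hpq
    · have h1 : (p : ℕ) ≤ q := hpq.le
      have h2 : (p : ℕ) + 1 ≤ q := hpq
      simp [h1, h2, hpq.ne]
    · simp
    · have h1 : ¬ (p : ℕ) ≤ q := not_le.2 hpq
      have h2 : ¬ (p : ℕ) + 1 ≤ q := by omega
      simp [h1, h2, hpq.ne']
  have h' (p : ℕ) (hp : p ≤ m) (j : ℕ) (hj : j < n) : suffixCount u p j = suffixCount w p j := by
    rcases hp.lt_or_eq with hp | rfl
    · exact h p hp j hj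
    · rw [hm, hm]
  ext p
  have key (j : Fin n) : (j : ℕ) ≤ u p ↔ (j : ℕ) ≤ w p := by
    have h1 := h' p p.2.le j j.2
    have h2 := h' (p + 1) p.2 j j.2
    rw [hstep, hstep, h2, add_right_inj] at h1
    by_cases hu : (j : ℕ) ≤ u p <;> by_cases hw : (j : ℕ) ≤ w p <;> simp [hu, hw] at h1 ⊢
  exact le_antisymm ((key (u p)).1 le_rfl) ((key (w p)).2 le_rfl)

theorem suffixCount_le_of_polytabloid_ne_zero {e : Fin m ≃ Fin k × Fin n}
    (he : ∀ c, StrictMono fun r => e.symm (c, r)) {u : Fin m → Fin n}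
    (hu : polytabloid f e u ≠ 0) (p j : ℕ) :
    suffixCount u p j ≤ suffixCount (fun q => (e q).2) p j := by
  rw [suffixCount_eq_sum e, suffixCount_eq_sum e]
  refine Finset.sum_le_sum fun c _ => ?_
  simp only [Equiv.apply_symm_apply]
  by_cases h : ∀ r : Fin n, p ≤ (e.symm (c, r) : ℕ) → j ≤ (r : ℕ)
  · refine Finset.card_le_card fun r hr => ?_
    simp only [Finset.mem_filter, Finset.mem_univ, true_and] at hr ⊢
    exact ⟨hr.1, h r hr.1⟩
  · push Not at h
    obtain ⟨r₀, hr₀, hj⟩ := h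
    refine Finset.card_le_card_of_injOn (fun r => u (e.symm (c, r))) (fun r hr => ?_)
      (injective_of_polytabloid_ne_zero hu c).injOn
    simp only [Finset.coe_filter, Finset.mem_univ, true_and, Set.mem_ofPred_eq] at hr ⊢
    refine ⟨hr₀.trans ?_, hr.2⟩
    exact (he c).monotone (Fin.le_def.2 (hj.le.trans hr.2))

theorem exists_tableau_of_isBallot {w : Fin (k * n) → Fin n} (hw : IsBallot w)
    (hk : letterCount w = fun _ => k) :
    ∃ e : Fin (k * n) ≃ Fin k × Fin n,
      (∀ p, (e p).2 = w p) ∧ ∀ c, StrictMono fun r => e.symm (c, r) := by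
  let col (p : Fin (k * n)) : ℕ := (Finset.univ.filter fun q => p < q ∧ w q = w p).card
  have hcol (p : Fin (k * n)) (s : ℕ) :
      s ≤ p ↔ col p < (Finset.univ.filter fun q : Fin (k * n) => s ≤ q ∧ w q = w p).card := by
    constructor
    · intro h
      refine Finset.card_lt_card (Finset.ssubset_iff_of_subset ?_ |>.2 ⟨p, ?_, ?_⟩)
      · intro q hq
        simp only [Finset.mem_filter, Finset.mem_univ, true_and] at hq ⊢
        exact ⟨h.trans hq.1.le, hq.2⟩
      · simpa using h
      · simp
    · intro h
      by_contra! hs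
      refine h.not_ge (Finset.card_le_card fun q hq => ?_)
      simp only [Finset.mem_filter, Finset.mem_univ, true_and] at hq ⊢
      exact ⟨Fin.lt_def.2 (hs.trans_le hq.1), hq.2⟩
  have hlt (p : Fin (k * n)) : col p < k := by
    have h := (hcol p 0).1 (Nat.zero_le _)
    simp only [Nat.zero_le, true_and] at h
    exact h.trans_eq (congrFun hk (w p))
  let g (p : Fin (k * n)) : Fin k × Fin n := (⟨col p, hlt p⟩, w p)
  have hg : Function.Injective g := by
    have aux (p q : Fin (k * n)) (h : g p = g q) : (p : ℕ) ≤ q := by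
      simp only [g, Prod.mk.injEq, Fin.mk.injEq] at h
      rw [hcol q p, ← h.1, ← h.2]
      exact (hcol p p).1 le_rfl
    exact fun p q h => Fin.ext (le_antisymm (aux p q h) (aux q p h.symm))
  have hbij : Function.Bijective g :=
    (Fintype.bijective_iff_injective_and_card g).2 ⟨hg, by simp⟩
  let e := Equiv.ofBijective g hbij
  refine ⟨e, fun p => rfl, fun c => ?_⟩
  have hspec (r : Fin n) : col (e.symm (c, r)) = c ∧ w (e.symm (c, r)) = r := by
    have h : g (e.symm (c, r)) = (c, r) := e.apply_symm_apply (c, r)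
    exact ⟨congrArg (fun x => (x.1 : ℕ)) h, congrArg Prod.snd h⟩
  refine Monotone.strictMono_of_injective (fun r s hrs => ?_) fun r s h => ?_
  · have h := (hcol (e.symm (c, r)) (e.symm (c, r))).1 le_rfl
    rw [(hspec r).1, (hspec r).2] at h
    refine Fin.le_def.2 ((hcol _ _).2 ?_)
    rw [(hspec s).1, (hspec s).2]
    exact h.trans_le (hw.monotone_suffix _ hrs)
  · simpa using h

end Polytabloid

/-- A family with unitriangular evaluations, with respect to a height function, is linearly
independent. -/
theorem linearIndependent_of_triangular {R ι α : Type*} [Field R] [Fintype ι] (b : ι → α → R)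
    (x : ι → α) (φ : ι → ℕ) (h1 : ∀ i, b i (x i) = 1)
    (h2 : ∀ i j, b i (x j) ≠ 0 → j = i ∨ φ j < φ i) : LinearIndependent R b := by
  classical
  rw [Fintype.linearIndependent_iff]
  intro c hc
  by_contra! hne
  obtain ⟨i, hi, hmax⟩ := Finset.exists_max_image (Finset.univ.filter fun i => c i ≠ 0) φ
    (by simpa [Finset.Nonempty] using hne)
  have h := congrFun hc (x i)
  simp only [Finset.sum_apply, Pi.smul_apply, smul_eq_mul, Pi.zero_apply] at h
  rw [Finset.sum_eq_single i, h1, mul_one] at h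
  · exact (Finset.mem_filter.1 hi).2 h
  · intro j _ hj
    by_contra hcj
    have hj' := hmax j (by simpa using left_ne_zero_of_mul hcj)
    rcases h2 j i (right_ne_zero_of_mul hcj) with h | h
    · exact hj h.symm
    · omega
  · simp

section Invariants

variable (f : Type*) [Field f] (n k : ℕ)

/-- The functions of words of length `m` that are fixed by all matrices of determinant one. -/
def wordInvariants (m : ℕ) : Submodule f ((Fin m → Fin n) → f) where
  carrier := {t | ∀ a : Matrix (Fin n) (Fin n) f, a.det = 1 → wordAct a t = t}
  add_mem' {s t} hs ht a ha := by
    conv_rhs => rw [← hs a ha, ← ht a ha]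
    ext w
    simp [wordAct, mul_add, Finset.sum_add_distrib]
  zero_mem' a _ := by
    ext w
    simp [wordAct]
  smul_mem' c t ht a ha := by
    conv_rhs => rw [← ht a ha]
    ext w
    simp [wordAct, Finset.mul_sum, mul_left_comm]

theorem finrank_wordInvariants_le [CharZero f] :
    Module.finrank f (wordInvariants f n (k * n)) ≤
      (ballotWords (k * n) n fun _ => k).card := by
  let S := ballotWords (k * n) n fun _ => k
  let res : wordInvariants f n (k * n) →ₗ[f] (S → f) :=
    (LinearMap.funLeft f f (Subtype.val : S → _)).comp (Submodule.subtype _)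
  have hres : Function.Injective res := by
    rw [← LinearMap.ker_eq_bot, LinearMap.ker_eq_bot']
    intro t ht
    by_contra h0
    obtain ⟨w, hw, htw⟩ := exists_mem_ballotWords_of_invariant t.2
      (fun h => h0 (Subtype.ext h))
    exact htw (congrFun ht ⟨w, hw⟩)
  simpa [S] using LinearMap.finrank_le_finrank_of_injective hres

theorem card_ballotWords_le_finrank_wordInvariants :
    (ballotWords (k * n) n fun _ => k).card ≤
      Module.finrank f (wordInvariants f n (k * n)) := by
  let S := ballotWords (k * n) n fun _ => k
  have hS (w : S) : ∃ e : Fin (k * n) ≃ Fin k × Fin n,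
      (∀ p, (e p).2 = w.1 p) ∧ ∀ c, StrictMono fun r => e.symm (c, r) := by
    have hw := w.2
    simp only [S, ballotWords, Finset.mem_filter, Finset.mem_univ, true_and] at hw
    exact exists_tableau_of_isBallot hw.1 hw.2
  choose e he hmono using hS
  have he' (w : S) : (fun p => (e w p).2) = w.1 := funext (he w)
  let φ (w : S) : ℕ :=
    ∑ x ∈ Finset.range (k * n) ×ˢ Finset.range n, suffixCount w.1 x.1 x.2
  have hli : LinearIndependent f fun w : S => polytabloid f (e w) := by
    refine linearIndependent_of_triangular _ Subtype.val φ (fun w => ?_) fun w u hu => ?_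
    · rw [← he' w]
      exact polytabloid_self _
    · have hle (x : ℕ × ℕ) : suffixCount u.1 x.1 x.2 ≤ suffixCount w.1 x.1 x.2 := by
        rw [← he' w]
        exact suffixCount_le_of_polytabloid_ne_zero (hmono w) hu x.1 x.2
      rcases (Finset.sum_le_sum fun x _ => hle x : φ u ≤ φ w).lt_or_eq with h | h
      · exact Or.inr h
      · left
        have h := (Finset.sum_eq_sum_iff_of_le fun x _ => hle x).1 h
        refine Subtype.ext (suffixCount_injective fun p hp j hj => h (p, j) ?_)
        simpa using ⟨hp, hj⟩
  have hli' : LinearIndependent f fun w : S =>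
      (⟨polytabloid f (e w), fun _ ha => wordAct_polytabloid (e w) ha⟩ :
        wordInvariants f n (k * n)) :=
    LinearIndependent.of_comp (Submodule.subtype _) hli
  simpa [S] using hli'.fintype_card_le_finrank

theorem finrank_slInvariants_eq (m : ℕ) :
    Module.finrank f (slInvariants f n m) = Module.finrank f (wordInvariants f n m) := by
  let B := Basis.piTensorProduct fun _ : Fin m => Pi.basisFun f (Fin n)
  have hact (a : Matrix (Fin n) (Fin n) f) (t) :
      B.equivFun (tensorAct f n m a t) = wordAct a (B.equivFun t) := by
    have hlin : IsLinearMap f (wordAct a : ((Fin m → Fin n) → f) → (Fin m → Fin n) → f) :=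
      { map_add := fun s t => by
          ext w
          simp [wordAct, mul_add, Finset.sum_add_distrib]
        map_smul := fun c t => by
          ext w
          simp [wordAct, Finset.mul_sum, mul_left_comm] }
    have : B.equivFun.toLinearMap ∘ₗ tensorAct f n m a =
        hlin.mk' _ ∘ₗ B.equivFun.toLinearMap := by
      refine B.ext fun u => funext fun w => ?_
      have h1 : B.equivFun (B u) = Pi.single u 1 := by
        ext v
        simp [Pi.single_apply, eq_comm]
      simp only [LinearMap.comp_apply, LinearEquiv.coe_coe, IsLinearMap.mk'_apply, h1]
      rw [wordAct, Finset.sum_eq_single u, Pi.single_eq_same, mul_one]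
      · simp [B, tensorAct, PiTensorProduct.map_tprod, Basis.piTensorProduct_repr_tprod_apply]
      · intro v _ hv
        rw [Pi.single_eq_of_ne hv, mul_zero]
      · simp
    exact LinearMap.congr_fun this t
  have hmap : (slInvariants f n m).map B.equivFun.toLinearMap = wordInvariants f n m := by
    ext t
    rw [Submodule.mem_map]
    constructor
    · rintro ⟨t, ht, rfl⟩ a ha
      exact (hact a t).symm.trans (congrArg B.equivFun (ht ⟨a, ha⟩))
    · intro ht
      refine ⟨B.equivFun.symm t, fun a => B.equivFun.injective ?_,
        B.equivFun.apply_symm_apply t⟩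
      rw [hact, LinearEquiv.apply_symm_apply]
      exact ht a.1 a.2
  rw [← hmap]
  exact (LinearEquiv.finrank_map_eq B.equivFun _).symm

end Invariants

theorem finrank_slInvariants (f : Type*) [Field f] [CharZero f] (n k : ℕ) :
    Module.finrank f (slInvariants f n (k * n)) *
        ∏ i ∈ Finset.range n, Nat.factorial (k + i) =
      Nat.factorial (k * n) * ∏ i ∈ Finset.range n, Nat.factorial i := by
  rw [finrank_slInvariants_eq, le_antisymm (finrank_wordInvariants_le f n k)
    (card_ballotWords_le_finrank_wordInvariants f n k)]
  exact card_ballotWords_const_mul n k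
end

section
/- The space of SL(2,f)-invariants in V^⊗(2k), V = f², has dimension equal to the Catalan number C_k = (2k)!/(k!(k+1)!). -/
open scoped TensorProduct

section SubsetFunctions

open Finset

variable {ι K : Type*} [Field K]

/-- The operator on functions of subsets summing over all ways to remove one element. -/
def loweringOp [DecidableEq ι] : Module.End K (Finset ι → K) where
  toFun x S := ∑ i ∈ S, x (S.erase i)
  map_add' x y := by ext S; simp [sum_add_distrib]
  map_smul' c x := by ext S; simp [mul_sum]

lemma loweringOp_apply [DecidableEq ι] (x : Finset ι → K) (S : Finset ι) :
    loweringOp x S = ∑ i ∈ S, x (S.erase i) := rfl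

/-- The operator scaling the value at `S` by `|ι| - 2 |S|`. -/
def weightOp [Fintype ι] : Module.End K (Finset ι → K) where
  toFun x S := ((Fintype.card ι : K) - 2 * #S) * x S
  map_add' x y := by ext S; simp [mul_add]
  map_smul' c x := by ext S; simp [mul_left_comm]

lemma weightOp_apply [Fintype ι] (x : Finset ι → K) (S : Finset ι) :
    weightOp x S = ((Fintype.card ι : K) - 2 * #S) * x S := rfl

variable [Fintype ι] [DecidableEq ι]

/-- The operator on functions of subsets summing over all ways to add one element. -/
def raisingOp : Module.End K (Finset ι → K) where
  toFun x S := ∑ i ∈ Sᶜ, x (insert i S)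
  map_add' x y := by ext S; simp [sum_add_distrib]
  map_smul' c x := by ext S; simp [mul_sum]

lemma raisingOp_apply (x : Finset ι → K) (S : Finset ι) :
    raisingOp x S = ∑ i ∈ Sᶜ, x (insert i S) := rfl

lemma raisingOp_loweringOp_apply (x : Finset ι → K) (S : Finset ι) :
    raisingOp (loweringOp x) S =
      #Sᶜ * x S + ∑ i ∈ Sᶜ, ∑ j ∈ S, x (insert i (S.erase j)) := by
  have h : ∀ i ∈ Sᶜ, loweringOp x (insert i S) = x S + ∑ j ∈ S, x (insert i (S.erase j)) := by
    intro i hi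
    rw [mem_compl] at hi
    rw [loweringOp_apply, sum_insert hi, erase_insert hi]
    congr 1
    refine sum_congr rfl fun j hj => ?_
    rw [erase_insert_of_ne (by rintro rfl; exact hi hj)]
  rw [raisingOp_apply, sum_congr rfl h, sum_add_distrib, sum_const, nsmul_eq_mul]

lemma loweringOp_raisingOp_apply (x : Finset ι → K) (S : Finset ι) :
    loweringOp (raisingOp x) S =
      #S * x S + ∑ i ∈ Sᶜ, ∑ j ∈ S, x (insert i (S.erase j)) := by
  have h : ∀ j ∈ S, raisingOp x (S.erase j) = x S + ∑ i ∈ Sᶜ, x (insert i (S.erase j)) := by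
    intro j hj
    rw [raisingOp_apply, compl_erase, sum_insert (by simpa using hj), insert_erase hj]
  rw [loweringOp_apply, sum_congr rfl h, sum_add_distrib, sum_const, nsmul_eq_mul, sum_comm]

lemma raisingOp_loweringOp_sub (x : Finset ι → K) :
    raisingOp (loweringOp x) - loweringOp (raisingOp x) = weightOp x := by
  ext S
  rw [Pi.sub_apply, raisingOp_loweringOp_apply, loweringOp_raisingOp_apply, weightOp_apply,
    card_compl, Nat.cast_sub (card_le_univ S)]
  ring

lemma weightOp_raisingOp_sub (x : Finset ι → K) :
    weightOp (raisingOp x) - raisingOp (weightOp x) = 2 • raisingOp x := by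
  ext S
  simp only [Pi.sub_apply, Pi.smul_apply, weightOp_apply, raisingOp_apply, mul_sum, smul_sum,
    ← sum_sub_distrib]
  refine sum_congr rfl fun i hi => ?_
  rw [card_insert_of_notMem (mem_compl.1 hi)]
  push_cast
  ring

lemma weightOp_loweringOp_sub (x : Finset ι → K) :
    weightOp (loweringOp x) - loweringOp (weightOp x) = -(2 • loweringOp x) := by
  ext S
  simp only [Pi.sub_apply, Pi.neg_apply, Pi.smul_apply, weightOp_apply, loweringOp_apply, mul_sum,
    smul_sum, ← sum_sub_distrib, ← sum_neg_distrib]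
  refine sum_congr rfl fun i hi => ?_
  rw [← card_erase_add_one hi]
  push_cast
  ring

attribute [local instance] LieRing.ofAssociativeRing

variable (ι K) in
lemma isSl2Triple_weightOp [CharZero K] [Nonempty ι] :
    IsSl2Triple (weightOp : Module.End K (Finset ι → K)) raisingOp loweringOp where
  h_ne_zero h := by
    have := congr_fun (LinearMap.congr_fun h 1) ∅
    simp [weightOp_apply] at this
  lie_e_f := LinearMap.ext raisingOp_loweringOp_sub
  lie_h_e_nsmul := LinearMap.ext weightOp_raisingOp_sub
  lie_h_f_nsmul := LinearMap.ext weightOp_loweringOp_sub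

lemma loweringOp_eq_zero [CharZero K] {x : Finset ι → K} (hE : raisingOp x = 0)
    (hH : weightOp x = 0) : loweringOp x = 0 := by
  cases isEmpty_or_nonempty ι
  · ext S
    simp [loweringOp_apply, Subsingleton.elim S ∅]
  by_cases hx : x = 0
  · simp [hx]
  have P : (isSl2Triple_weightOp ι K).HasPrimitiveVectorWith x (0 : K) :=
    ⟨hx, by simpa using hH, hE⟩
  simpa using P.pow_toEnd_f_eq_zero_of_eq_nat (n := 0) (by simp)

lemma eq_zero_of_loweringOp_eq_zero [CharZero K] {x : Finset ι → K} (hF : loweringOp x = 0)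
    {n : ℕ} (hn : n ≠ 0) (hH : weightOp x = (n : K) • x) : x = 0 := by
  cases isEmpty_or_nonempty ι
  · ext S
    have := congr_fun hH S
    simpa [weightOp_apply, Subsingleton.elim S ∅, hn, eq_comm] using this
  by_contra hx
  have P : (isSl2Triple_weightOp ι K).symm.HasPrimitiveVectorWith x (-n : K) := by
    refine ⟨hx, ?_, hF⟩
    rw [neg_smul, ← hH]
    rfl
  obtain ⟨l, hl⟩ := P.exists_nat
  have : ((n + l : ℕ) : K) = 0 := by push_cast; rw [← hl]; ring
  rw [Nat.cast_eq_zero] at this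
  omega

end SubsetFunctions

section Exponential

open Finset Polynomial

variable {ι K : Type*} [Fintype ι] [DecidableEq ι] [Field K]

/-- The polynomial in `s` giving the value at `S` of `exp (s E) x`, for `E` the raising operator. -/
noncomputable def expRaising (x : Finset ι → K) (S : Finset ι) : K[X] :=
  ∑ A with S ⊆ A, C (x A) * X ^ #(A \ S)

lemma eval_expRaising (x : Finset ι → K) (S : Finset ι) (s : K) :
    (expRaising x S).eval s = ∑ A, (if S ⊆ A then s ^ #(A \ S) else 0) * x A := by
  simp only [expRaising, eval_finsetSum, eval_mul, eval_C, eval_pow, eval_X, ite_mul, zero_mul,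
    ← sum_filter]
  exact sum_congr rfl fun A _ => mul_comm _ _

lemma eval_zero_expRaising (x : Finset ι → K) (S : Finset ι) :
    (expRaising x S).eval 0 = x S := by
  rw [eval_expRaising, sum_eq_single S]
  · simp
  · intro A _ hA
    split_ifs with h
    · rw [zero_pow, zero_mul]
      rw [Ne, card_eq_zero, sdiff_eq_empty_iff_subset]
      exact fun h' => hA (h'.antisymm h)
    · simp
  · simp

lemma derivative_expRaising (x : Finset ι → K) (S : Finset ι) :
    derivative (expRaising x S) = expRaising (raisingOp x) S := by
  have hl : derivative (expRaising x S) =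
      ∑ A with S ⊆ A, ∑ _i ∈ A \ S, C (x A) * X ^ (#(A \ S) - 1) := by
    simp only [expRaising, derivative_sum, derivative_C_mul, derivative_X_pow, sum_const,
      nsmul_eq_mul, map_natCast]
    exact sum_congr rfl fun A _ => by ring
  have hr : expRaising (raisingOp x) S =
      ∑ B with S ⊆ B, ∑ i ∈ Bᶜ, C (x (insert i B)) * X ^ #(B \ S) := by
    simp only [expRaising, raisingOp_apply, map_sum, sum_mul]
  rw [hl, hr, sum_sigma', sum_sigma']
  refine sum_nbij' (fun p => ⟨p.1.erase p.2, p.2⟩) (fun p => ⟨insert p.2 p.1, p.2⟩) ?_ ?_ ?_ ?_ ?_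
  · rintro ⟨A, i⟩ h
    simp only [mem_sigma, mem_filter_univ, mem_sdiff] at h
    simp [subset_erase, h.1, h.2.2]
  · rintro ⟨B, i⟩ h
    simp only [mem_sigma, mem_filter_univ, mem_compl] at h
    simpa using ⟨h.1.trans (subset_insert i B), fun hi => h.2 (h.1 hi)⟩
  · rintro ⟨A, i⟩ h
    simp only [mem_sigma, mem_filter_univ, mem_sdiff] at h
    simp [insert_erase h.2.1]
  · rintro ⟨B, i⟩ h
    simp only [mem_sigma, mem_filter_univ, mem_compl] at h
    simp [erase_insert h.2]
  · rintro ⟨A, i⟩ h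
    simp only [mem_sigma, mem_filter_univ, mem_sdiff] at h
    rw [insert_erase h.2.1, erase_sdiff_comm, card_erase_of_mem (mem_sdiff.2 h.2)]

lemma raisingOp_eq_zero_iff [CharZero K] (x : Finset ι → K) :
    raisingOp x = 0 ↔
      ∀ (s : K) S, ∑ A, (if S ⊆ A then s ^ #(A \ S) else 0) * x A = x S := by
  simp_rw [← eval_expRaising]
  constructor
  · intro h s S
    have hd : derivative (expRaising x S) = 0 := by
      rw [derivative_expRaising, h]
      simp [expRaising]
    rw [← eval_zero_expRaising x S, eq_C_of_derivative_eq_zero hd, eval_C, eval_C]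
  · intro h
    ext S
    have hc : expRaising x S = C (x S) := Polynomial.funext fun s => by rw [h, eval_C]
    rw [← eval_zero_expRaising (raisingOp x) S, ← derivative_expRaising, hc]
    simp

lemma loweringOp_apply_compl (x : Finset ι → K) (S : Finset ι) :
    loweringOp x Sᶜ = raisingOp (fun A => x Aᶜ) S := by
  simp [loweringOp_apply, raisingOp_apply, compl_insert]

lemma loweringOp_eq_zero_iff [CharZero K] (x : Finset ι → K) :
    loweringOp x = 0 ↔
      ∀ (s : K) S, ∑ A, (if A ⊆ S then s ^ #(S \ A) else 0) * x A = x S := by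
  have h : loweringOp x = 0 ↔ raisingOp (fun A => x Aᶜ) = 0 := by
    simp only [funext_iff, ← loweringOp_apply_compl, Pi.zero_apply]
    exact compl_surjective.forall
  rw [h, raisingOp_eq_zero_iff]
  refine forall_congr' fun s => ?_
  rw [compl_surjective.forall]
  refine forall_congr' fun S => ?_
  rw [compl_compl, ← (compl_involutive (α := Finset ι)).bijective.sum_comp]
  simp only [compl_compl, compl_subset_compl, compl_sdiff_compl]

end Exponential

section TensorCoordinates

open Finset

/-- Words in two letters correspond to subsets of their positions, via the positions of `1`. -/
def wordEquivFinset (ι : Type*) [Fintype ι] [DecidableEq ι] : (ι → Fin 2) ≃ Finset ι where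
  toFun p := {i | p i = 1}
  invFun S i := if i ∈ S then 1 else 0
  left_inv p := by
    funext i
    by_cases h : p i = 1
    · simp [h]
    · simp [show p i = 0 by omega]
  right_inv S := by ext; simp

variable (f : Type*) [Field f] (m : ℕ)

/-- Coordinates of tensors over `f²` in the standard basis, indexed by subsets of the factors. -/
noncomputable def tensorCoord :
    (⨂[f] _ : Fin m, (Fin 2 → f)) ≃ₗ[f] (Finset (Fin m) → f) :=
  ((Basis.piTensorProduct fun _ : Fin m => Pi.basisFun f (Fin 2)).reindex
    (wordEquivFinset (Fin m))).equivFun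

variable {f m}

lemma tensorCoord_tprod (v : Fin m → Fin 2 → f) (S : Finset (Fin m)) :
    tensorCoord f m (PiTensorProduct.tprod f v) S = ∏ i, v i (if i ∈ S then 1 else 0) := by
  rw [tensorCoord, Module.Basis.equivFun_apply, Module.Basis.repr_reindex_apply,
    Basis.piTensorProduct_repr_tprod_apply]
  rfl

lemma tensorCoord_tensorAct (a : Matrix (Fin 2) (Fin 2) f) (t : ⨂[f] _ : Fin m, (Fin 2 → f))
    (S : Finset (Fin m)) :
    tensorCoord f m (tensorAct f 2 m a t) S =
      ∑ A : Finset (Fin m), (∏ i, a (if i ∈ S then 1 else 0) (if i ∈ A then 1 else 0)) *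
        tensorCoord f m t A := by
  induction t using PiTensorProduct.induction_on with
  | smul_tprod r v =>
    simp only [map_smul, Pi.smul_apply, smul_eq_mul, mul_left_comm _ r, ← mul_sum, tensorAct,
      PiTensorProduct.map_tprod, tensorCoord_tprod, ← prod_mul_distrib]
    congr 1
    simp only [Matrix.mulVecLin_apply, Matrix.mulVec, dotProduct]
    rw [prod_univ_sum, Fintype.piFinset_univ, ← (wordEquivFinset (Fin m)).symm.sum_comp]
    rfl
  | add x y hx hy => simp only [map_add, Pi.add_apply, hx, hy, mul_add, sum_add_distrib]

lemma tensorCoord_tensorAct_upper (s : f) (t : ⨂[f] _ : Fin m, (Fin 2 → f))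
    (S : Finset (Fin m)) :
    tensorCoord f m (tensorAct f 2 m !![1, s; 0, 1] t) S =
      ∑ A, (if S ⊆ A then s ^ #(A \ S) else 0) * tensorCoord f m t A := by
  rw [tensorCoord_tensorAct]
  refine sum_congr rfl fun A _ => congrArg (· * _) ?_
  split_ifs with h
  · rw [← prod_const, ← prod_subset (subset_univ (A \ S))]
    · refine prod_congr rfl fun i hi => ?_
      rw [mem_sdiff] at hi
      simp [hi.1, hi.2]
    · intro i _ hi
      by_cases hS : i ∈ S
      · simp [hS, h hS]
      · have hA : i ∉ A := fun hA => hi (mem_sdiff.2 ⟨hA, hS⟩)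
        simp [hS, hA]
  · obtain ⟨i, hS, hA⟩ := not_subset.1 h
    exact prod_eq_zero (mem_univ i) (by simp [hS, hA])

lemma tensorCoord_tensorAct_lower (s : f) (t : ⨂[f] _ : Fin m, (Fin 2 → f))
    (S : Finset (Fin m)) :
    tensorCoord f m (tensorAct f 2 m !![1, 0; s, 1] t) S =
      ∑ A, (if A ⊆ S then s ^ #(S \ A) else 0) * tensorCoord f m t A := by
  rw [tensorCoord_tensorAct]
  refine sum_congr rfl fun A _ => congrArg (· * _) ?_
  split_ifs with h
  · rw [← prod_const, ← prod_subset (subset_univ (S \ A))]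
    · refine prod_congr rfl fun i hi => ?_
      rw [mem_sdiff] at hi
      simp [hi.1, hi.2]
    · intro i _ hi
      by_cases hA : i ∈ A
      · simp [hA, h hA]
      · have hS : i ∉ S := fun hS => hi (mem_sdiff.2 ⟨hS, hA⟩)
        simp [hS, hA]
  · obtain ⟨i, hA, hS⟩ := not_subset.1 h
    exact prod_eq_zero (mem_univ i) (by simp [hS, hA])

lemma tensorAct_mul (n : ℕ) (a b : Matrix (Fin n) (Fin n) f) (t : ⨂[f] _ : Fin m, (Fin n → f)) :
    tensorAct f n m (a * b) t = tensorAct f n m a (tensorAct f n m b t) := by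
  simp only [tensorAct, Matrix.mulVecLin_mul, PiTensorProduct.map_comp, LinearMap.comp_apply]

/-- A property of `2 × 2` matrices closed under products that holds for elementary unipotent
matrices holds for all matrices of determinant one. -/
lemma Matrix.det_one_induction_fin_two {P : Matrix (Fin 2) (Fin 2) f → Prop}
    (hmul : ∀ a b, P a → P b → P (a * b)) (upper : ∀ s, P !![1, s; 0, 1])
    (lower : ∀ s, P !![1, 0; s, 1]) {a : Matrix (Fin 2) (Fin 2) f} (ha : a.det = 1) : P a := by
  have key : ∀ b : Matrix (Fin 2) (Fin 2) f, b.det = 1 → b 1 0 ≠ 0 → P b := by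
    intro b hb hc
    rw [Matrix.det_fin_two] at hb
    have : b = !![1, (b 0 0 - 1) / b 1 0; 0, 1] * !![1, 0; b 1 0, 1] *
        !![1, (b 1 1 - 1) / b 1 0; 0, 1] := by
      ext i j
      fin_cases i <;> fin_cases j <;> simp [Matrix.mul_apply, Fin.sum_univ_two] <;> field_simp <;>
        first | ring1 | linear_combination -hb
    rw [this]
    exact hmul _ _ (hmul _ _ (upper _) (lower _)) (upper _)
  by_cases hc : a 1 0 = 0
  · have h0 : a 0 0 ≠ 0 := by
      intro h0
      simp [Matrix.det_fin_two, h0, hc] at ha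
    have : a = !![1, 0; -1, 1] * (!![1, 0; 1, 1] * a) := by
      rw [← mul_assoc]
      simp [← Matrix.one_fin_two]
    rw [this]
    refine hmul _ _ (lower _) (key _ ?_ ?_)
    · rw [Matrix.det_mul, ha, Matrix.det_fin_two_of]
      ring
    · simp [Matrix.mul_apply, Fin.sum_univ_two, hc, h0]
  · exact key a ha hc

lemma mem_slInvariants_two_iff [CharZero f] (t : ⨂[f] _ : Fin m, (Fin 2 → f)) :
    t ∈ slInvariants f 2 m ↔
      raisingOp (tensorCoord f m t) = 0 ∧ loweringOp (tensorCoord f m t) = 0 := by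
  have hu : (∀ s : f, tensorAct f 2 m !![1, s; 0, 1] t = t) ↔
      raisingOp (tensorCoord f m t) = 0 := by
    simp only [raisingOp_eq_zero_iff, ← tensorCoord_tensorAct_upper, ← funext_iff,
      EmbeddingLike.apply_eq_iff_eq]
  have hl : (∀ s : f, tensorAct f 2 m !![1, 0; s, 1] t = t) ↔
      loweringOp (tensorCoord f m t) = 0 := by
    simp only [loweringOp_eq_zero_iff, ← tensorCoord_tensorAct_lower, ← funext_iff,
      EmbeddingLike.apply_eq_iff_eq]
  rw [← hu, ← hl]
  constructor
  · intro h
    exact ⟨fun s => h ⟨!![1, s; 0, 1], by simp [Matrix.det_fin_two_of]⟩,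
      fun s => h ⟨!![1, 0; s, 1], by simp [Matrix.det_fin_two_of]⟩⟩
  · rintro ⟨h₁, h₂⟩ a
    refine Matrix.det_one_induction_fin_two (P := fun a => tensorAct f 2 m a t = t) ?_ h₁ h₂ a.2
    intro a b ha hb
    rw [tensorAct_mul, hb, ha]

lemma map_tensorCoord_slInvariants [CharZero f] :
    (slInvariants f 2 m).map (tensorCoord f m).toLinearMap =
      LinearMap.ker raisingOp ⊓ LinearMap.ker weightOp := by
  ext x
  obtain ⟨t, rfl⟩ := (tensorCoord f m).surjective x
  rw [Submodule.mem_map_equiv, LinearEquiv.symm_apply_apply, mem_slInvariants_two_iff]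
  simp only [Submodule.mem_inf, LinearMap.mem_ker]
  refine and_congr_right fun hE => ⟨fun hF => ?_, loweringOp_eq_zero hE⟩
  rw [← raisingOp_loweringOp_sub, hE, hF, map_zero, map_zero, sub_zero]

end TensorCoordinates

section Dimension

open Finset

variable {ι K : Type*} [Field K]

variable (K) in
/-- Extension by zero of functions on the subsets satisfying `p`. -/
noncomputable def extendSubsets (p : Finset ι → Prop) :
    ({S // p S} → K) →ₗ[K] (Finset ι → K) :=
  Function.ExtendByZero.linearMap K Subtype.val

lemma extendSubsets_apply {p : Finset ι → Prop} (y : {S // p S} → K) (S : {S // p S}) :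
    extendSubsets K p y S = y S :=
  Subtype.val_injective.extend_apply y (0 : Finset ι → K) S

lemma extendSubsets_apply_of_not {p : Finset ι → Prop} (y : {S // p S} → K) {S : Finset ι}
    (hS : ¬ p S) : extendSubsets K p y S = 0 :=
  Function.extend_apply' y (0 : Finset ι → K) S fun ⟨A, hA⟩ => hS (hA ▸ A.2)

lemma extendSubsets_injective (p : Finset ι → Prop) :
    Function.Injective (extendSubsets K p) := fun y z h => by
  ext S
  rw [← extendSubsets_apply y, h, extendSubsets_apply]

lemma extendSubsets_restrict {p : Finset ι → Prop} {x : Finset ι → K}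
    (hx : ∀ S, ¬ p S → x S = 0) : extendSubsets K p (fun S => x S) = x := by
  ext S
  by_cases hS : p S
  · exact extendSubsets_apply (fun S : {S // p S} => x S) ⟨S, hS⟩
  · rw [extendSubsets_apply_of_not _ hS, hx S hS]

lemma extendSubsets_single [DecidableEq ι] {p : Finset ι → Prop} (S : {S // p S}) :
    extendSubsets K p (Pi.single S 1) = Pi.single S.1 1 := by
  ext A
  by_cases hA : p A
  · rw [extendSubsets_apply _ ⟨A, hA⟩, Pi.single_apply, Pi.single_apply]
    simp [Subtype.ext_iff]
  · rw [extendSubsets_apply_of_not _ hA, Pi.single_eq_of_ne (by rintro rfl; exact hA S.2)]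

/-- The block of an operator mapping functions on subsets satisfying `p` to functions on subsets
satisfying `q`. -/
noncomputable def subsetBlock (T : Module.End K (Finset ι → K)) (p q : Finset ι → Prop) :
    ({S // p S} → K) →ₗ[K] ({S // q S} → K) :=
  LinearMap.funLeft K K Subtype.val ∘ₗ T ∘ₗ extendSubsets K p

lemma subsetBlock_apply (T : Module.End K (Finset ι → K)) {p q : Finset ι → Prop}
    (y : {S // p S} → K) (S : {S // q S}) :
    subsetBlock T p q y S = T (extendSubsets K p y) S := rfl

variable [Fintype ι] [DecidableEq ι]

lemma raisingOp_single_apply (S A : Finset ι) :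
    raisingOp (Pi.single A (1 : K)) S = loweringOp (Pi.single S (1 : K)) A := by
  simp only [raisingOp_apply, loweringOp_apply, Pi.single_apply, sum_boole]
  congr 2
  ext i
  simp only [mem_filter, mem_compl]
  constructor
  · rintro ⟨h, rfl⟩
    exact ⟨mem_insert_self i S, erase_insert h⟩
  · rintro ⟨h, rfl⟩
    exact ⟨notMem_erase i A, insert_erase h⟩

lemma finrank_range_subsetBlock_raisingOp (p q : Finset ι → Prop) :
    Module.finrank K (LinearMap.range (subsetBlock (K := K) raisingOp p q)) =
      Module.finrank K (LinearMap.range (subsetBlock (K := K) loweringOp q p)) := by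
  classical
  have h : LinearMap.toMatrix' (subsetBlock (K := K) raisingOp p q) =
      (LinearMap.toMatrix' (subsetBlock (K := K) loweringOp q p)).transpose := by
    ext S A
    simp only [LinearMap.toMatrix'_apply, Matrix.transpose_apply, subsetBlock_apply,
      extendSubsets_single, raisingOp_single_apply]
  have h' := congrArg Matrix.rank h
  rwa [Matrix.rank_transpose, Matrix.rank, Matrix.rank, ← Matrix.toLin'_apply',
    ← Matrix.toLin'_apply', Matrix.toLin'_toMatrix', Matrix.toLin'_toMatrix'] at h'

lemma subsetBlock_loweringOp_injective [CharZero K] {k : ℕ} (hk : Fintype.card ι = 2 * k) :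
    Function.Injective (subsetBlock (K := K) (ι := ι) loweringOp (#· + 1 = k) (#· = k)) := by
  rw [injective_iff_map_eq_zero]
  intro y hy
  apply extendSubsets_injective
  rw [map_zero]
  refine eq_zero_of_loweringOp_eq_zero ?_ two_ne_zero ?_
  · ext A
    by_cases hA : #A = k
    · exact congr_fun hy ⟨A, hA⟩
    · refine sum_eq_zero fun i hi => extendSubsets_apply_of_not _ ?_
      rwa [card_erase_add_one hi]
  · ext S
    rw [weightOp_apply, Pi.smul_apply, smul_eq_mul]
    by_cases hS : #S + 1 = k
    · have hk' : (k : K) = #S + 1 := by rw [← hS]; push_cast; ring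
      rw [hk]
      push_cast
      rw [hk']
      ring
    · rw [extendSubsets_apply_of_not _ hS, mul_zero, mul_zero]

lemma map_extendSubsets_ker [CharZero K] {k : ℕ} (hk : Fintype.card ι = 2 * k) :
    (LinearMap.ker (subsetBlock (K := K) (ι := ι) raisingOp (#· = k) (#· + 1 = k))).map
        (extendSubsets K (#· = k)) = LinearMap.ker raisingOp ⊓ LinearMap.ker weightOp := by
  ext x
  simp only [Submodule.mem_map, LinearMap.mem_ker, Submodule.mem_inf]
  constructor
  · rintro ⟨y, hy, rfl⟩
    constructor
    · ext S
      by_cases hS : #S + 1 = k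
      · exact congr_fun hy ⟨S, hS⟩
      · refine sum_eq_zero fun i hi => extendSubsets_apply_of_not _ ?_
        rwa [card_insert_of_notMem (mem_compl.1 hi)]
    · ext S
      rw [weightOp_apply, Pi.zero_apply]
      by_cases hS : #S = k
      · rw [hk, hS]
        push_cast
        ring
      · rw [extendSubsets_apply_of_not _ hS, mul_zero]
  · rintro ⟨hE, hH⟩
    have hx : extendSubsets K (#· = k) (fun S => x S) = x := by
      refine extendSubsets_restrict fun S hS => ?_
      refine (mul_eq_zero.1 (congr_fun hH S)).resolve_left fun h => hS ?_
      rw [hk, sub_eq_zero] at h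
      norm_cast at h
      omega
    refine ⟨fun S => x S, ?_, hx⟩
    ext S
    rw [subsetBlock_apply, hx, hE]
    rfl

lemma finrank_ker_raisingOp_inf_ker_weightOp [CharZero K] {k : ℕ}
    (hk : Fintype.card ι = 2 * k) :
    Module.finrank K
        (LinearMap.ker raisingOp ⊓ LinearMap.ker weightOp : Submodule K (Finset ι → K)) +
      Fintype.card {S : Finset ι // #S + 1 = k} = k.centralBinom := by
  have h := LinearMap.finrank_range_add_finrank_ker
    (subsetBlock (K := K) (ι := ι) raisingOp (#· = k) (#· + 1 = k))
  rw [finrank_range_subsetBlock_raisingOp,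
    LinearMap.finrank_range_of_inj (subsetBlock_loweringOp_injective hk),
    Module.finrank_fintype_fun_eq_card, Module.finrank_fintype_fun_eq_card,
    Fintype.card_finset_len, hk] at h
  rw [← map_extendSubsets_ker hk, ← LinearEquiv.finrank_eq (Submodule.equivMapOfInjective _
    (extendSubsets_injective _) _), add_comm, h, Nat.centralBinom]

end Dimension

lemma catalan_add_card_finset {ι : Type*} [Fintype ι] {k : ℕ} (hk : Fintype.card ι = 2 * k) :
    catalan k + Fintype.card {S : Finset ι // S.card + 1 = k} = k.centralBinom := by
  obtain _ | j := k
  · simp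
  have hc : Fintype.card {S : Finset ι // S.card + 1 = j + 1} = (2 * (j + 1)).choose j := by
    simp_rw [Nat.add_right_cancel_iff]
    rw [Fintype.card_finset_len, hk]
  have h₁ := succ_mul_catalan_eq_centralBinom (j + 1)
  have h₂ := Nat.choose_succ_right_eq (2 * (j + 1)) j
  rw [show 2 * (j + 1) - j = j + 2 by omega, ← Nat.centralBinom_eq_two_mul_choose] at h₂
  rw [hc]
  refine Nat.eq_of_mul_eq_mul_left (Nat.succ_pos (j + 1)) ?_
  simp only [Nat.succ_eq_add_one]
  linarith

theorem finrank_sl2_invariants_eq_catalan (f : Type*) [Field f] [CharZero f] (k : ℕ) :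
    Module.finrank f (slInvariants f 2 (2 * k)) = catalan k ∧
    catalan k * (Nat.factorial k * Nat.factorial (k + 1)) = Nat.factorial (2 * k) := by
  constructor
  · have hk : Fintype.card (Fin (2 * k)) = 2 * k := Fintype.card_fin _
    have h := finrank_ker_raisingOp_inf_ker_weightOp (K := f) hk
    rw [← map_tensorCoord_slInvariants, LinearEquiv.finrank_map_eq,
      ← catalan_add_card_finset hk] at h
    exact Nat.add_right_cancel h
  · have h := Nat.choose_mul_factorial_mul_factorial (show k ≤ 2 * k by omega)
    rw [← Nat.centralBinom_eq_two_mul_choose, ← succ_mul_catalan_eq_centralBinom,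
      show 2 * k - k = k by omega] at h
    rw [← h, Nat.factorial_succ]
    ring
end

section
/- The tensors t_G, parametrized by all n-wave graphs G with m vertices, form a basis of the space of SL(n,f)-invariants in V^⊗m, where V = f^n is the standard representation of SL(n,f) and f has characteristic 0. -/
open scoped TensorProduct

/-- An `n`-wave graph on `k * n` vertices, encoded as a bijection sending each vertex to
(its component, its position in the component): positions within a component are
increasingly ordered, components are labeled by the order of their first vertices,
and on every page `N` (carrying the `N`-th edge of every component) no two edges cross. -/
def IsWaveStruct {k n : ℕ} (hn : 0 < n) (e : Fin (k * n) ≃ Fin k × Fin n) : Prop :=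
  (∀ j : Fin k, StrictMono fun i : Fin n => e.symm (j, i)) ∧
  (StrictMono fun j : Fin k => e.symm (j, ⟨0, hn⟩)) ∧
  (∀ (j j' : Fin k) (N : ℕ) (h : N + 1 < n),
    ¬(e.symm (j, ⟨N, Nat.lt_of_succ_lt h⟩) < e.symm (j', ⟨N, Nat.lt_of_succ_lt h⟩) ∧
      e.symm (j', ⟨N, Nat.lt_of_succ_lt h⟩) < e.symm (j, ⟨N + 1, h⟩) ∧
      e.symm (j, ⟨N + 1, h⟩) < e.symm (j', ⟨N + 1, h⟩)))

/-- The tensor `t_G = Σ_{g ∈ O(G)} (-1)^{inv g} b_g` attached to a wave graph (or to any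
partition of the `k * n` tensor positions into `k` ordered blocks of size `n`): the sum
over all orientations of each block of the signed standard monomials, i.e. the image of
`(x₁ ∧ ⋯ ∧ xₙ)^{⊗ k}` under the permutation of tensor factors determined by `e`. -/
noncomputable def waveTensor (f : Type*) [Field f] {k n : ℕ}
    (e : Fin (k * n) ≃ Fin k × Fin n) : ⨂[f] _ : Fin (k * n), (Fin n → f) :=
  ∑ c : Fin k → Equiv.Perm (Fin n),
    (∏ j : Fin k, (Equiv.Perm.sign (c j) : ℤ)) •
      ⨂ₜ[f] v, Pi.single ((c (e v).1) ((e v).2)) (1 : f)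

section Coefficients

variable {f : Type*} [Field f] {n m : ℕ}

/-- The coefficient of a tensor at the standard monomial spelled by a word. -/
noncomputable def wordCoeff (f : Type*) [Field f] {n m : ℕ} (w : Fin m → Fin n) :
    (⨂[f] _ : Fin m, (Fin n → f)) →ₗ[f] f :=
  (Basis.piTensorProduct fun _ : Fin m => Pi.basisFun f (Fin n)).coord w

theorem wordCoeff_tprod (w : Fin m → Fin n) (x : Fin m → Fin n → f) :
    wordCoeff f w (⨂ₜ[f] p, x p) = ∏ p, x p (w p) := by
  simp [wordCoeff]

theorem ext_wordCoeff {t t' : ⨂[f] _ : Fin m, (Fin n → f)}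
    (h : ∀ w, wordCoeff f w t = wordCoeff f w t') : t = t' :=
  (Basis.piTensorProduct fun _ : Fin m => Pi.basisFun f (Fin n)).ext_elem h

theorem wordCoeff_tensorAct (a : Matrix (Fin n) (Fin n) f) (w : Fin m → Fin n)
    (t : ⨂[f] _ : Fin m, (Fin n → f)) :
    wordCoeff f w (tensorAct f n m a t) =
      ∑ w' : Fin m → Fin n, (∏ p, a (w p) (w' p)) * wordCoeff f w' t := by
  induction t using PiTensorProduct.induction_on with
  | smul_tprod r x =>
    simp only [map_smul, tensorAct, PiTensorProduct.map_tprod, wordCoeff_tprod, smul_eq_mul,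
      Matrix.mulVecLin_apply, Matrix.mulVec, dotProduct, Finset.prod_univ_sum,
      Fintype.piFinset_univ, Finset.mul_sum, Finset.prod_mul_distrib]
    exact Finset.sum_congr rfl fun w' _ => by ring
  | add t t' ht ht' => simp only [map_add, ht, ht', mul_add, Finset.sum_add_distrib]

theorem wordCoeff_tensorAct_waveTensor {k : ℕ} (a : Matrix (Fin n) (Fin n) f)
    (e : Fin (k * n) ≃ Fin k × Fin n) (w : Fin (k * n) → Fin n) :
    wordCoeff f w (tensorAct f n (k * n) a (waveTensor f e)) =
      ∏ j, (a.submatrix (fun i => w (e.symm (j, i))) id).det := by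
  have h (c : Fin k → Equiv.Perm (Fin n)) :
      ∏ v, a (w v) (c (e v).1 (e v).2) = ∏ j, ∏ i, a (w (e.symm (j, i))) (c j i) := by
    rw [← Fintype.prod_prod_type' (f := fun j i => a (w (e.symm (j, i))) (c j i)),
      ← e.prod_comp]
    simp
  simp only [waveTensor, map_sum, map_zsmul, tensorAct, PiTensorProduct.map_tprod,
    wordCoeff_tprod, Matrix.mulVecLin_apply, Matrix.mulVec_single_one, Matrix.col_apply, h]
  simp_rw [← Matrix.det_transpose (a.submatrix _ _), Matrix.det_apply', Finset.prod_univ_sum,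
    Fintype.piFinset_univ, Finset.prod_mul_distrib]
  exact Finset.sum_congr rfl fun c _ => by simp [zsmul_eq_mul]

theorem wordCoeff_waveTensor {k : ℕ} (e : Fin (k * n) ≃ Fin k × Fin n)
    (w : Fin (k * n) → Fin n) :
    wordCoeff f w (waveTensor f e) =
      ∏ j, ((1 : Matrix (Fin n) (Fin n) f).submatrix (fun i => w (e.symm (j, i))) id).det := by
  rw [← wordCoeff_tensorAct_waveTensor, tensorAct, Matrix.mulVecLin_one, PiTensorProduct.map_id,
    LinearMap.id_apply]

theorem waveTensor_mem_slInvariants {k : ℕ} (e : Fin (k * n) ≃ Fin k × Fin n) :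
    waveTensor f e ∈ slInvariants f n (k * n) := by
  intro a
  refine ext_wordCoeff fun w => ?_
  rw [wordCoeff_tensorAct_waveTensor, wordCoeff_waveTensor]
  refine Finset.prod_congr rfl fun j _ => ?_
  have h : (a : Matrix (Fin n) (Fin n) f).submatrix (fun i => w (e.symm (j, i))) id =
      (1 : Matrix (Fin n) (Fin n) f).submatrix (fun i => w (e.symm (j, i))) id * a := by
    ext i i'
    simp [Matrix.mul_apply, Matrix.one_apply]
  rw [h, Matrix.det_mul, a.det_coe, mul_one]

theorem wordCoeff_waveTensor_self {k : ℕ} (e : Fin (k * n) ≃ Fin k × Fin n) :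
    wordCoeff f (fun v => (e v).2) (waveTensor f e) = 1 := by
  rw [wordCoeff_waveTensor]
  refine Finset.prod_eq_one fun j _ => ?_
  simp only [Equiv.apply_symm_apply]
  exact Matrix.det_one

/-- The word reading off the position of each vertex in its component is the lexicographically
smallest one occurring in the tensor, as soon as the components are increasing. -/
theorem toLex_le_of_wordCoeff_waveTensor_ne_zero {k : ℕ} {e : Fin (k * n) ≃ Fin k × Fin n}
    (he : ∀ j, StrictMono fun i => e.symm (j, i)) {w : Fin (k * n) → Fin n}
    (hw : wordCoeff f w (waveTensor f e) ≠ 0) :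
    toLex (fun v => (e v).2) ≤ toLex w := by
  by_contra! hlt
  obtain ⟨v, hv, hwv⟩ := hlt
  have hwv : w v < (e v).2 := hwv
  have hlt : e.symm ((e v).1, w v) < v := by
    simpa using he (e v).1 hwv
  have hcoll : w (e.symm ((e v).1, w v)) = w (e.symm ((e v).1, (e v).2)) := by
    simpa using hv _ hlt
  rw [wordCoeff_waveTensor] at hw
  refine hw (Finset.prod_eq_zero (Finset.mem_univ (e v).1) ?_)
  refine Matrix.det_zero_of_row_eq hwv.ne ?_
  ext i
  exact congrArg (fun l => (1 : Matrix (Fin n) (Fin n) f) l i) hcoll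

end Coefficients

section NonCrossing

variable {n k : ℕ}

theorem IsWaveStruct.not_lt_of_next {hn : 0 < n} {e e' : Fin (k * n) ≃ Fin k × Fin n}
    (he : IsWaveStruct hn e) (he' : IsWaveStruct hn e') (h : ∀ v, (e v).2 = (e' v).2)
    {N : ℕ} (hN : N + 1 < n)
    (hprev : ∀ j, e.symm (j, ⟨N, Nat.lt_of_succ_lt hN⟩) = e'.symm (j, ⟨N, Nat.lt_of_succ_lt hN⟩))
    {v : Fin (k * n)} (hv : (e v).2 = ⟨N + 1, hN⟩)
    (ih : ∀ x < v, (e x).2 = ⟨N + 1, hN⟩ → (e x).1 = (e' x).1) :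
    ¬ e.symm ((e v).1, ⟨N, Nat.lt_of_succ_lt hN⟩) <
      e.symm ((e' v).1, ⟨N, Nat.lt_of_succ_lt hN⟩) := by
  intro hlt
  have hv' : (e' v).2 = ⟨N + 1, hN⟩ := by rw [← h, hv]
  have ev : e.symm ((e v).1, ⟨N + 1, hN⟩) = v := by rw [← hv]; simp
  have ev' : e'.symm ((e' v).1, ⟨N + 1, hN⟩) = v := by rw [← hv']; simp
  have hbelow : e.symm ((e' v).1, ⟨N, Nat.lt_of_succ_lt hN⟩) < v := by
    rw [hprev]
    conv_rhs => rw [← ev']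
    exact he'.1 _ (Fin.mk_lt_mk.2 (Nat.lt_succ_self N))
  have hx : e.symm ((e' v).1, ⟨N + 1, hN⟩) ≤ v := by
    by_contra! hx
    exact he.2.2 (e v).1 (e' v).1 N hN ⟨hlt, by rwa [ev], by rwa [ev]⟩
  rcases hx.lt_or_eq with hx | hx
  · have hfst := ih _ hx (by simp)
    have hsnd := h (e.symm ((e' v).1, ⟨N + 1, hN⟩))
    simp only [Equiv.apply_symm_apply] at hfst hsnd
    refine hx.ne (e'.injective (Prod.ext hfst.symm ?_))
    rw [← hsnd, hv']
  · have hj : (e' v).1 = (e v).1 := by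
      rw [Equiv.symm_apply_eq] at hx
      exact (congrArg Prod.fst hx :)
    rw [hj] at hlt
    exact lt_irrefl _ hlt

/-- A wave graph is determined by its word. -/
theorem IsWaveStruct.eq_of_snd_eq {hn : 0 < n} {e e' : Fin (k * n) ≃ Fin k × Fin n}
    (he : IsWaveStruct hn e) (he' : IsWaveStruct hn e')
    (h : ∀ v, (e v).2 = (e' v).2) : e = e' := by
  have key : ∀ (N : ℕ) (hN : N < n) (j : Fin k), e.symm (j, ⟨N, hN⟩) = e'.symm (j, ⟨N, hN⟩) := by
    intro N
    induction N with
    | zero =>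
      intro hN
      refine congrFun ((he.2.1.range_inj he'.2.1).1 ?_)
      have hrange (d : Fin (k * n) ≃ Fin k × Fin n) :
          (Set.range fun j => d.symm (j, ⟨0, hn⟩)) = {v | (d v).2 = ⟨0, hn⟩} := by
        ext v
        constructor
        · rintro ⟨j, rfl⟩
          simp
        · intro hv
          refine ⟨(d v).1, ?_⟩
          rw [Equiv.symm_apply_eq]
          exact Prod.ext rfl hv.symm
      rw [hrange, hrange]
      simp only [h]
    | succ N ihN =>
      intro hN
      have hprev := ihN (Nat.lt_of_succ_lt hN)
      have hfst : ∀ v, (e v).2 = ⟨N + 1, hN⟩ → (e v).1 = (e' v).1 := by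
        intro v
        induction v using WellFoundedLT.induction with
        | ind v ih =>
          intro hv
          have h1 := he.not_lt_of_next he' h hN hprev hv ih
          have h2 := he'.not_lt_of_next he (fun v => (h v).symm) hN (fun j => (hprev j).symm)
            (by rw [← h, hv]) fun x hx hx' => (ih x hx (by rw [h, hx'])).symm
          rw [← hprev, ← hprev] at h2
          simpa using le_antisymm (not_lt.1 h2) (not_lt.1 h1)
      intro j
      have hfst := hfst (e.symm (j, ⟨N + 1, hN⟩)) (by simp)
      have hsnd := h (e.symm (j, ⟨N + 1, hN⟩))
      rw [Equiv.eq_symm_apply]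
      simp only [Equiv.apply_symm_apply] at hfst hsnd
      exact Prod.ext hfst.symm hsnd.symm
  have hsymm : e.symm = e'.symm := Equiv.ext fun p => key p.2 p.2.2 p.1
  simpa using congrArg Equiv.symm hsymm

theorem Fin.strictMono_of_lt_next {α : Type*} [Preorder α] {g : Fin n → α}
    (h : ∀ (N : ℕ) (hN : N + 1 < n), g ⟨N, Nat.lt_of_succ_lt hN⟩ < g ⟨N + 1, hN⟩) :
    StrictMono g := by
  cases n with
  | zero => exact fun i => i.elim0
  | succ n => exact Fin.strictMono_iff_lt_succ.2 fun i => h i (Nat.succ_lt_succ i.2)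

/-- In every prefix of a lattice word, each letter occurs at least as often as the next one. -/
def IsLatticeWord {m : ℕ} (w : Fin m → Fin n) : Prop :=
  ∀ (N : ℕ) (hN : N + 1 < n) (r : ℕ),
    Finset.card {v : Fin m | (v : ℕ) < r ∧ w v = ⟨N + 1, hN⟩} ≤
      Finset.card {v : Fin m | (v : ℕ) < r ∧ w v = ⟨N, Nat.lt_of_succ_lt hN⟩}

/-- The components are increasing and labeled by the order of their first vertices. -/
def IsOrdered (hn : 0 < n) (e : Fin (k * n) ≃ Fin k × Fin n) : Prop :=
  (∀ j, StrictMono fun i => e.symm (j, i)) ∧ StrictMono fun j => e.symm (j, ⟨0, hn⟩)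

theorem IsLatticeWord.exists_isOrdered (hn : 0 < n) {w : Fin (k * n) → Fin n}
    (hw : IsLatticeWord w) (hcard : ∀ i, Finset.card {v | w v = i} = k) :
    ∃ e : Fin (k * n) ≃ Fin k × Fin n, IsOrdered hn e ∧ ∀ v, (e v).2 = w v := by
  let s (p : Fin k × Fin n) : Fin (k * n) := Finset.orderEmbOfFin {v | w v = p.2} (hcard p.2) p.1
  have hs (p : Fin k × Fin n) : w (s p) = p.2 := by
    exact (Finset.mem_filter.1 (Finset.orderEmbOfFin_mem {v | w v = p.2} (hcard p.2) p.1)).2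
  have smono (i : Fin n) : StrictMono fun j => s (j, i) :=
    (Finset.orderEmbOfFin {v | w v = i} (hcard i)).strictMono
  have hrange {v : Fin (k * n)} {i : Fin n} (hv : w v = i) : ∃ j, s (j, i) = v := by
    have : v ∈ Set.range (Finset.orderEmbOfFin {v | w v = i} (hcard i)) := by
      simpa [Finset.range_orderEmbOfFin] using hv
    exact this
  have sinj : Function.Injective s := by
    rintro ⟨j, i⟩ ⟨j', i'⟩ h
    obtain rfl : i = i' := (hs (j, i)).symm.trans ((congrArg w h).trans (hs (j', i')))
    rw [(smono i).injective h]
  let d : Fin k × Fin n ≃ Fin (k * n) :=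
    Equiv.ofBijective s ((Fintype.bijective_iff_injective_and_card s).2 ⟨sinj, by simp⟩)
  refine ⟨d.symm, ⟨fun j => Fin.strictMono_of_lt_next fun N hN => ?_, smono _⟩, fun v => ?_⟩
  · change s (j, _) < s (j, _)
    by_contra! hle
    have hlow : (j : ℕ) + 1 ≤
        Finset.card {v : Fin (k * n) |
          (v : ℕ) < s (j, ⟨N + 1, hN⟩) + 1 ∧ w v = ⟨N + 1, hN⟩} := by
      rw [← Fin.card_Iic j, ← Finset.card_image_of_injective _ (smono ⟨N + 1, hN⟩).injective]
      refine Finset.card_le_card fun v hv => ?_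
      obtain ⟨j', hj', rfl⟩ := Finset.mem_image.1 hv
      have := (smono ⟨N + 1, hN⟩).monotone (Finset.mem_Iic.1 hj')
      simp only [Finset.mem_filter, Finset.mem_univ, true_and, hs, and_true]
      exact Nat.lt_succ_of_le this
    have hhigh : Finset.card {v : Fin (k * n) |
        (v : ℕ) < s (j, ⟨N + 1, hN⟩) + 1 ∧ w v = ⟨N, Nat.lt_of_succ_lt hN⟩} ≤ (j : ℕ) := by
      rw [← Fin.card_Iio j,
        ← Finset.card_image_of_injective _ (smono ⟨N, Nat.lt_of_succ_lt hN⟩).injective]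
      refine Finset.card_le_card fun v hv => ?_
      simp only [Finset.mem_filter, Finset.mem_univ, true_and] at hv
      obtain ⟨j', rfl⟩ := hrange hv.2
      refine Finset.mem_image.2 ⟨j', Finset.mem_Iio.2 ?_, rfl⟩
      rw [← (smono ⟨N, Nat.lt_of_succ_lt hN⟩).lt_iff_lt]
      refine lt_of_lt_of_le (lt_of_le_of_ne (Nat.lt_succ_iff.1 hv.1) fun h => ?_) hle
      simpa using sinj h
    exact absurd (hlow.trans ((hw N hN _).trans hhigh)) (by simp)
  · obtain ⟨p, rfl⟩ := d.surjective v
    rw [Equiv.symm_apply_apply]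
    exact (hs p).symm

/-- Exchange the labels `j` and `j'` at all positions beyond `N`. -/
def swapTails (j j' : Fin k) (N : ℕ) : Equiv.Perm (Fin k × Fin n) where
  toFun p := (if (p.2 : ℕ) ≤ N then p.1 else Equiv.swap j j' p.1, p.2)
  invFun p := (if (p.2 : ℕ) ≤ N then p.1 else Equiv.swap j j' p.1, p.2)
  left_inv p := by ext <;> dsimp; split_ifs <;> simp
  right_inv p := by ext <;> dsimp; split_ifs <;> simp

theorem IsOrdered.swapTails {hn : 0 < n} {e : Fin (k * n) ≃ Fin k × Fin n} (he : IsOrdered hn e)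
    {j j' : Fin k} {N : ℕ} (h : N + 1 < n)
    (h1 : e.symm (j, ⟨N, Nat.lt_of_succ_lt h⟩) < e.symm (j', ⟨N, Nat.lt_of_succ_lt h⟩))
    (h2 : e.symm (j', ⟨N, Nat.lt_of_succ_lt h⟩) < e.symm (j, ⟨N + 1, h⟩))
    (h3 : e.symm (j, ⟨N + 1, h⟩) < e.symm (j', ⟨N + 1, h⟩)) :
    IsOrdered hn (e.trans (swapTails j j' N)) := by
  refine ⟨fun a => Fin.strictMono_of_lt_next fun M hM => ?_, fun a b hab => ?_⟩
  · change e.symm (if M ≤ N then a else Equiv.swap j j' a, _) <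
      e.symm (if M + 1 ≤ N then a else Equiv.swap j j' a, _)
    rcases lt_trichotomy M N with hlt | rfl | hlt
    · rw [if_pos hlt.le, if_pos (Nat.succ_le_of_lt hlt)]
      exact he.1 a (Fin.mk_lt_mk.2 M.lt_succ_self)
    · rw [if_pos le_rfl, if_neg (Nat.not_succ_le_self M)]
      rcases eq_or_ne a j with rfl | haj
      · rw [Equiv.swap_apply_left]
        exact h1.trans (h2.trans h3)
      rcases eq_or_ne a j' with rfl | haj'
      · rwa [Equiv.swap_apply_right]
      rw [Equiv.swap_apply_of_ne_of_ne haj haj']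
      exact he.1 a (Fin.mk_lt_mk.2 M.lt_succ_self)
    · rw [if_neg hlt.not_ge, if_neg (by omega)]
      exact he.1 _ (Fin.mk_lt_mk.2 M.lt_succ_self)
  · change e.symm (if 0 ≤ N then a else _, _) < e.symm (if 0 ≤ N then b else _, _)
    rw [if_pos N.zero_le, if_pos N.zero_le]
    exact he.2 hab

/-- A quantity that strictly decreases when a crossing is removed. -/
def crossingWeight (e : Fin (k * n) ≃ Fin k × Fin n) : ℤ :=
  ∑ M : Fin n, ∑ a : Fin k,
    if hM : (M : ℕ) + 1 < n then
      ((e.symm (a, M) : ℕ) : ℤ) * ((e.symm (a, ⟨M + 1, hM⟩) : ℕ) : ℤ) else 0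

theorem crossingWeight_swapTails_lt {e : Fin (k * n) ≃ Fin k × Fin n}
    {j j' : Fin k} {N : ℕ} (h : N + 1 < n)
    (h1 : e.symm (j, ⟨N, Nat.lt_of_succ_lt h⟩) < e.symm (j', ⟨N, Nat.lt_of_succ_lt h⟩))
    (h3 : e.symm (j, ⟨N + 1, h⟩) < e.symm (j', ⟨N + 1, h⟩)) :
    crossingWeight (e.trans (swapTails j j' N)) < crossingWeight e := by
  have hsymm (a : Fin k) (M : Fin n) : (e.trans (swapTails j j' N)).symm (a, M) =
    e.symm (if (M : ℕ) ≤ N then a else Equiv.swap j j' a, M) := rfl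
  have hlt : ∑ a : Fin k, ((e.symm (a, ⟨N, Nat.lt_of_succ_lt h⟩) : ℕ) : ℤ) *
        ((e.symm (Equiv.swap j j' a, ⟨N + 1, h⟩) : ℕ) : ℤ) <
      ∑ a : Fin k, ((e.symm (a, ⟨N, Nat.lt_of_succ_lt h⟩) : ℕ) : ℤ) *
        ((e.symm (a, ⟨N + 1, h⟩) : ℕ) : ℤ) := by
    rw [← sub_pos, ← Finset.sum_sub_distrib]
    have hne : j ≠ j' := by
      rintro rfl
      exact lt_irrefl _ h1
    rw [Fintype.sum_eq_add j j' hne fun a ha => by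
      rw [Equiv.swap_apply_of_ne_of_ne ha.1 ha.2, sub_self]]
    rw [Equiv.swap_apply_left, Equiv.swap_apply_right]
    have h1' : ((e.symm (j, ⟨N, Nat.lt_of_succ_lt h⟩) : ℕ) : ℤ) <
      ((e.symm (j', ⟨N, Nat.lt_of_succ_lt h⟩) : ℕ) : ℤ) := by exact_mod_cast h1
    have h3' : ((e.symm (j, ⟨N + 1, h⟩) : ℕ) : ℤ) <
      ((e.symm (j', ⟨N + 1, h⟩) : ℕ) : ℤ) := by exact_mod_cast h3
    nlinarith [mul_pos (sub_pos.2 h1') (sub_pos.2 h3')]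
  refine Finset.sum_lt_sum (fun M _ => ?_) ⟨⟨N, Nat.lt_of_succ_lt h⟩, Finset.mem_univ _, ?_⟩
  · by_cases hM : (M : ℕ) + 1 < n
    · simp only [hM, dif_pos, hsymm]
      rcases lt_trichotomy (M : ℕ) N with hMN | hMN | hMN
      · simp [hMN.le, Nat.succ_le_of_lt hMN]
      · obtain rfl : M = ⟨N, Nat.lt_of_succ_lt h⟩ := Fin.ext hMN
        simpa using hlt.le
      · have h' : ¬ (M : ℕ) + 1 ≤ N := by omega
        simp only [hMN.not_ge, h', if_false]
        exact (Equiv.sum_comp (Equiv.swap j j') fun a => ((e.symm (a, M) : ℕ) : ℤ) *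
          ((e.symm (a, ⟨M + 1, hM⟩) : ℕ) : ℤ)).le
    · simp [hM]
  · simpa only [h, hsymm, dif_pos, le_refl, if_true, Nat.not_succ_le_self, if_false] using hlt

/-- Every lattice word in which each letter occurs `k` times comes from a wave graph. -/
theorem IsLatticeWord.exists_isWaveStruct (hn : 0 < n) {w : Fin (k * n) → Fin n}
    (hw : IsLatticeWord w) (hcard : ∀ i, Finset.card {v | w v = i} = k) :
    ∃ e : Fin (k * n) ≃ Fin k × Fin n, IsWaveStruct hn e ∧ ∀ v, (e v).2 = w v := by
  obtain ⟨e, he, hmin⟩ := Set.exists_min_image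
    {e : Fin (k * n) ≃ Fin k × Fin n | IsOrdered hn e ∧ ∀ v, (e v).2 = w v} crossingWeight
    (Set.toFinite _) (hw.exists_isOrdered hn hcard)
  refine ⟨e, ⟨he.1.1, he.1.2, fun j j' N h ⟨h1, h2, h3⟩ => ?_⟩, he.2⟩
  exact (hmin _ ⟨he.1.swapTails h h1 h2 h3, he.2⟩).not_gt (crossingWeight_swapTails_lt h h1 h3)

end NonCrossing

section LetterOperators

attribute [local instance] LieRing.ofAssociativeRing

variable {f : Type*} [Field f] {n m : ℕ}

/-- The matrix unit `E i j` acting on the letter at position `q`, in terms of coefficients of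
words. -/
def letterOp (f : Type*) [Field f] {n m : ℕ} (q : Fin m) (i j : Fin n) :
    Module.End f ((Fin m → Fin n) → f) where
  toFun c w := if w q = i then c (Function.update w q j) else 0
  map_add' c c' := by ext w; dsimp; split_ifs <;> simp
  map_smul' a c := by ext w; simp

theorem letterOp_apply (q : Fin m) (i j : Fin n) (c : (Fin m → Fin n) → f) (w : Fin m → Fin n) :
    letterOp f q i j c w = if w q = i then c (Function.update w q j) else 0 := rfl

theorem letterOp_mul_self (q : Fin m) (i j i' j' : Fin n) :
    letterOp f q i j * letterOp f q i' j' = if j = i' then letterOp f q i j' else 0 := by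
  refine LinearMap.ext fun c => funext fun w => ?_
  rcases eq_or_ne j i' with rfl | h <;> simp [letterOp_apply, *]

theorem letterOp_commute {q q' : Fin m} (h : q ≠ q') (i j i' j' : Fin n) :
    Commute (letterOp f q i j) (letterOp f q' i' j') := by
  refine LinearMap.ext fun c => funext fun w => ?_
  simp only [Module.End.mul_apply, letterOp_apply, Function.update_of_ne h,
    Function.update_of_ne h.symm, Function.update_comm h]
  split_ifs <;> rfl

/-- The matrix unit `E i j` acting as a derivation on the letters at the positions in `S`. -/
def lettersOp (f : Type*) [Field f] {n m : ℕ} (S : Finset (Fin m)) (i j : Fin n) :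
    Module.End f ((Fin m → Fin n) → f) :=
  ∑ q ∈ S, letterOp f q i j

theorem lettersOp_apply (S : Finset (Fin m)) (i j : Fin n) (c : (Fin m → Fin n) → f)
    (w : Fin m → Fin n) :
    lettersOp f S i j c w = ∑ q ∈ S, if w q = i then c (Function.update w q j) else 0 := by
  simp [lettersOp, letterOp_apply, LinearMap.sum_apply, Finset.sum_apply]

theorem lettersOp_self_apply (S : Finset (Fin m)) (i : Fin n) (c : (Fin m → Fin n) → f)
    (w : Fin m → Fin n) :
    lettersOp f S i i c w = (Finset.card {q ∈ S | w q = i} : f) * c w := by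
  rw [lettersOp_apply, Finset.card_filter, Nat.cast_sum, Finset.sum_mul]
  refine Finset.sum_congr rfl fun q _ => ?_
  split_ifs with h
  · subst h
    simp
  · simp

theorem lie_lettersOp (S : Finset (Fin m)) (i j i' j' : Fin n) :
    ⁅lettersOp f S i j, lettersOp f S i' j'⁆ =
      (if j = i' then lettersOp f S i j' else 0) - (if j' = i then lettersOp f S i' j else 0) := by
  have h (q : Fin m) (hq : q ∈ S) :
      ∑ q' ∈ S, ⁅letterOp f q i j, letterOp f q' i' j'⁆ =
        (if j = i' then letterOp f q i j' else 0) - (if j' = i then letterOp f q i' j else 0) := by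
    rw [Finset.sum_eq_single_of_mem q hq fun q' _ hq' =>
      (letterOp_commute hq'.symm i j i' j').lie_eq]
    rw [Ring.lie_def, letterOp_mul_self, letterOp_mul_self]
  rw [lettersOp, lettersOp, sum_lie_sum, Finset.sum_congr rfl h, Finset.sum_sub_distrib]
  simp only [lettersOp]
  split_ifs <;> simp

theorem exists_nat_of_lettersOp_eq_zero [CharZero f] {S : Finset (Fin m)} {i j : Fin n}
    (hij : i ≠ j) {x : (Fin m → Fin n) → f} (hx : x ≠ 0) (h0 : lettersOp f S i j x = 0) {μ : f}
    (hμ : (lettersOp f S i i - lettersOp f S j j) x = μ • x) : ∃ N : ℕ, μ = N := by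
  by_cases hzero : lettersOp f S i i - lettersOp f S j j = 0
  · refine ⟨0, ?_⟩
    rw [hzero, LinearMap.zero_apply] at hμ
    simpa using (smul_eq_zero_iff_left hx).1 hμ.symm
  have t : IsSl2Triple (lettersOp f S i i - lettersOp f S j j) (lettersOp f S i j)
      (lettersOp f S j i) :=
    { h_ne_zero := hzero
      lie_e_f := by simp [lie_lettersOp]
      lie_h_e_nsmul := by
        rw [sub_lie, lie_lettersOp, lie_lettersOp]
        simp [hij.symm, two_smul]
      lie_h_f_nsmul := by
        rw [sub_lie, lie_lettersOp, lie_lettersOp]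
        simp [hij, two_smul]
        abel }
  have P : t.HasPrimitiveVectorWith x μ := ⟨hx, hμ, h0⟩
  exact P.exists_nat

theorem card_eq_card_of_lettersOp_eq_zero [CharZero f] {c : (Fin m → Fin n) → f}
    (hc : ∀ i j, i ≠ j → lettersOp f Finset.univ i j c = 0) {w : Fin m → Fin n} (hw : c w ≠ 0)
    (i j : Fin n) : Finset.card {q | w q = i} = Finset.card {q | w q = j} := by
  rcases eq_or_ne i j with rfl | hij
  · rfl
  have hlie := lie_lettersOp (f := f) (Finset.univ : Finset (Fin m)) i j j i
  simp only [if_true] at hlie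
  have h : (lettersOp f Finset.univ i i - lettersOp f Finset.univ j j :
      Module.End f ((Fin m → Fin n) → f)) c = 0 := by
    rw [← hlie, Ring.lie_def, LinearMap.sub_apply, Module.End.mul_apply, Module.End.mul_apply,
      hc i j hij, hc j i hij.symm, map_zero, map_zero, sub_zero]
  have h := congrFun h w
  rw [LinearMap.sub_apply, Pi.sub_apply, lettersOp_self_apply, lettersOp_self_apply, ← sub_mul,
    Pi.zero_apply, mul_eq_zero, or_iff_left hw, sub_eq_zero] at h
  exact_mod_cast h

/-- The lexicographically smallest word occurring in a vector killed by all root vectors is a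
lattice word. -/
theorem isLatticeWord_of_minimal [CharZero f] {c : (Fin m → Fin n) → f}
    (hc : ∀ i j, i ≠ j → lettersOp f Finset.univ i j c = 0) {w₀ : Fin m → Fin n} (hw₀ : c w₀ ≠ 0)
    (hmin : ∀ w, c w ≠ 0 → toLex w₀ ≤ toLex w) : IsLatticeWord w₀ := by
  intro N hN r
  set l : Fin n := ⟨N, Nat.lt_of_succ_lt hN⟩
  set l' : Fin n := ⟨N + 1, hN⟩
  have hll : l < l' := Fin.mk_lt_mk.2 N.lt_succ_self
  let S : Finset (Fin m) := {q | r ≤ (q : ℕ)}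
  let x : (Fin m → Fin n) → f := fun w => if ∀ q : Fin m, (q : ℕ) < r → w q = w₀ q then c w else 0
  have hx : x ≠ 0 := fun h => hw₀ (by simpa [x] using congrFun h w₀)
  have hkill : lettersOp f S l' l x = 0 := by
    funext w
    rw [lettersOp_apply, Pi.zero_apply]
    have hagree (q : Fin m) (hq : q ∈ S) :
        (∀ q' : Fin m, (q' : ℕ) < r → Function.update w q l q' = w₀ q') ↔
          ∀ q' : Fin m, (q' : ℕ) < r → w q' = w₀ q' := by
      refine forall₂_congr fun q' hq' => ?_
      rw [Function.update_of_ne]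
      rintro rfl
      exact (Finset.mem_filter.1 hq).2.not_gt hq'
    by_cases hw : ∀ q : Fin m, (q : ℕ) < r → w q = w₀ q
    · have htotal := congrFun (hc l' l hll.ne') w
      rw [lettersOp_apply, Pi.zero_apply] at htotal
      refine Eq.trans ?_ htotal
      refine Finset.sum_congr_of_eq_on_inter ?_ ?_ ?_
      · intro q _ hq
        exact absurd (Finset.mem_univ q) hq
      · intro q _ hq
        have hqr : (q : ℕ) < r := by simpa [S] using hq
        split_ifs with hwq
        · by_contra hne
          refine (hmin _ hne).not_gt ⟨q, fun q' hq' => ?_, ?_⟩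
          · have hq'' : q' < q := hq'
            change Function.update w q l q' = w₀ q'
            rw [Function.update_of_ne hq''.ne]
            exact hw q' (lt_trans hq'' hqr)
          · change Function.update w q l q < w₀ q
            rwa [Function.update_self, ← hw q hqr, hwq]
        · rfl
      · intro q hq _
        have hxc : x (Function.update w q l) = c (Function.update w q l) :=
          if_pos ((hagree q hq).2 hw)
        rw [hxc]
    · refine Finset.sum_eq_zero fun q hq => ?_
      simp only [x, hagree q hq, hw, if_false, ite_self]
  have hsplit (w : Fin m → Fin n) (i : Fin n) (hw : ∀ q : Fin m, (q : ℕ) < r → w q = w₀ q) :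
      Finset.card {q ∈ S | w q = i} + Finset.card {q : Fin m | (q : ℕ) < r ∧ w₀ q = i} =
        Finset.card {q : Fin m | w q = i} := by
    rw [← Finset.card_filter_add_card_filter_not (s := {q : Fin m | w q = i})
      (fun q => r ≤ (q : ℕ))]
    congr 2
    · ext q
      simp [S, and_comm]
    · ext q
      simp only [Finset.mem_filter, Finset.mem_univ, true_and, not_le]
      exact ⟨fun h => ⟨by rw [hw q h.1, h.2], h.1⟩, fun h => ⟨h.2, by rw [← hw q h.2, h.1]⟩⟩
  have hweight : (lettersOp f S l' l' - lettersOp f S l l) x =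
      ((Finset.card {q : Fin m | (q : ℕ) < r ∧ w₀ q = l} : f) -
        (Finset.card {q : Fin m | (q : ℕ) < r ∧ w₀ q = l'} : f)) • x := by
    funext w
    rw [LinearMap.sub_apply, Pi.sub_apply, lettersOp_self_apply, lettersOp_self_apply, ← sub_mul,
      Pi.smul_apply, smul_eq_mul]
    by_cases hxw : x w = 0
    · rw [hxw, mul_zero, mul_zero]
    have hw : ∀ q : Fin m, (q : ℕ) < r → w q = w₀ q := by
      by_contra hw
      exact hxw (if_neg hw)
    have hcw : c w ≠ 0 := by simpa only [x, if_pos hw] using hxw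
    have hsum := card_eq_card_of_lettersOp_eq_zero hc hcw l' l
    rw [← hsplit w l' hw, ← hsplit w l hw] at hsum
    congr 1
    rw [sub_eq_sub_iff_add_eq_add]
    exact_mod_cast hsum.trans (add_comm _ _)
  obtain ⟨d, hd⟩ := exists_nat_of_lettersOp_eq_zero hll.ne' hx hkill hweight
  rw [sub_eq_iff_eq_add] at hd
  have hd : Finset.card {q : Fin m | (q : ℕ) < r ∧ w₀ q = l} =
    d + Finset.card {q : Fin m | (q : ℕ) < r ∧ w₀ q = l'} := by exact_mod_cast hd
  exact hd ▸ Nat.le_add_left _ _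

open Polynomial in
/-- Invariants are killed by all root vectors of the Lie algebra. -/
theorem lettersOp_wordCoeff_eq_zero [CharZero f] {t : ⨂[f] _ : Fin m, (Fin n → f)}
    (ht : t ∈ slInvariants f n m) {i j : Fin n} (hij : i ≠ j) :
    lettersOp f Finset.univ i j (fun w => wordCoeff f w t) = 0 := by
  funext w
  let g (w' : Fin m → Fin n) (p : Fin m) : f[X] :=
    C ((1 : Matrix (Fin n) (Fin n) f) (w p) (w' p)) + X * C (if i = w p ∧ j = w' p then 1 else 0)
  have hpoly : ∑ w', (∏ p, g w' p) * C (wordCoeff f w' t) = C (wordCoeff f w t) := by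
    refine Polynomial.funext fun s => ?_
    have hs := ht ⟨Matrix.transvection i j s, Matrix.det_transvection_of_ne i j hij s⟩
    have hs := congrArg (wordCoeff f w) hs
    rw [wordCoeff_tensorAct] at hs
    rw [eval_C, ← hs]
    simp [g, eval_finsetSum, eval_prod, Matrix.transvection, Matrix.single_apply,
      -mul_ite, apply_ite (eval s)]
    simp only [mul_ite, mul_one, mul_zero]
  have hder := congrArg (fun P => eval 0 (derivative P)) hpoly
  simp only [derivative_sum, derivative_mul, derivative_C, mul_zero, add_zero, eval_finsetSum,
    eval_mul, eval_C, derivative_prod_finset, eval_prod, eval_zero, Finset.sum_mul, g, eval_add,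
    derivative_add, derivative_X, eval_X, zero_mul, one_mul, zero_add] at hder
  rw [Finset.sum_comm] at hder
  rw [lettersOp_apply, Pi.zero_apply]
  refine Eq.trans ?_ hder
  refine Finset.sum_congr rfl fun p _ => ?_
  rw [Finset.sum_eq_single (Function.update w p j)]
  · rw [Finset.prod_eq_one fun q hq => by
      rw [Function.update_of_ne (Finset.ne_of_mem_erase hq), Matrix.one_apply_eq]]
    simp [eq_comm]
  · intro w' _ hw'
    by_cases hp : i = w p ∧ j = w' p
    · obtain ⟨q, hq⟩ := Function.ne_iff.1 hw'
      have hqp : q ≠ p := by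
        rintro rfl
        exact hq (by rw [Function.update_self, hp.2])
      rw [Function.update_of_ne hqp] at hq
      have hprod : ∏ q ∈ Finset.univ.erase p,
          (1 : Matrix (Fin n) (Fin n) f) (w q) (w' q) = 0 :=
        Finset.prod_eq_zero (Finset.mem_erase.2 ⟨hqp, Finset.mem_univ q⟩)
          (Matrix.one_apply_ne hq.symm)
      rw [hprod, zero_mul, zero_mul]
    · rw [if_neg hp, mul_zero, zero_mul]
  · simp

end LetterOperators

/-- A nonzero invariant has a nonzero coefficient at the word of some wave graph. -/
theorem exists_wordCoeff_ne_zero {f : Type*} [Field f] [CharZero f] {k n : ℕ} (hn : 0 < n)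
    {t : ⨂[f] _ : Fin (k * n), (Fin n → f)} (ht : t ∈ slInvariants f n (k * n)) (h0 : t ≠ 0) :
    ∃ e : Fin (k * n) ≃ Fin k × Fin n, IsWaveStruct hn e ∧
      wordCoeff f (fun v => (e v).2) t ≠ 0 := by
  have hne : {w : Fin (k * n) → Fin n | wordCoeff f w t ≠ 0}.Nonempty := by
    by_contra! hempty
    refine h0 (ext_wordCoeff fun w => ?_)
    rw [map_zero]
    by_contra hw
    exact Set.eq_empty_iff_forall_notMem.1 hempty w hw
  obtain ⟨w, hw, hmin⟩ := Set.exists_min_image _ (fun w => toLex w) (Set.toFinite _) hne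
  have hkill (i j : Fin n) (hij : i ≠ j) := lettersOp_wordCoeff_eq_zero ht hij
  have hcard (i : Fin n) : Finset.card {v | w v = i} = k := by
    have hsum := Finset.card_eq_sum_card_fiberwise (f := w) (s := Finset.univ)
      (t := Finset.univ) (by simp)
    rw [Finset.sum_congr rfl fun j _ => card_eq_card_of_lettersOp_eq_zero hkill hw j i] at hsum
    simp only [Finset.card_univ, Fintype.card_fin, Finset.sum_const, smul_eq_mul] at hsum
    exact (Nat.eq_of_mul_eq_mul_left hn (by rw [← hsum, mul_comm]))
  obtain ⟨e, he, hew⟩ :=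
    (isLatticeWord_of_minimal hkill hw hmin).exists_isWaveStruct hn hcard
  obtain rfl : (fun v => (e v).2) = w := funext hew
  exact ⟨e, he, hw⟩

theorem linearIndependent_waveTensor (f : Type*) [Field f] (k n : ℕ) (hn : 0 < n) :
    LinearIndependent f
      (fun G : {e : Fin (k * n) ≃ Fin k × Fin n // IsWaveStruct hn e} => waveTensor f G.val) := by
  classical
  rw [Fintype.linearIndependent_iff]
  intro a ha
  by_contra! hne
  obtain ⟨G, hG, hmin⟩ := Set.exists_min_image {G | a G ≠ 0} (fun G => toLex fun v => (G.val v).2)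
    (Set.toFinite _) hne
  have hcoeff := congrArg (wordCoeff f fun v => (G.val v).2) ha
  rw [map_sum, map_zero, Finset.sum_eq_single G, map_smul, wordCoeff_waveTensor_self, smul_eq_mul,
    mul_one] at hcoeff
  · exact hG hcoeff
  · intro G' _ hG'
    rw [map_smul, smul_eq_zero]
    by_contra! h
    have hle := toLex_le_of_wordCoeff_waveTensor_ne_zero G'.2.1 h.2
    have heq := toLex_inj.1 (le_antisymm hle (hmin G' h.1))
    exact hG' (Subtype.ext (G'.2.eq_of_snd_eq G.2 (congrFun heq)))
  · simp

/-- Main theorem: the tensors `t_G`, parametrized by the `n`-wave graphs `G` on `k * n`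
vertices, form a basis of the space of `SL(n,f)`-invariants of the `(k*n)`-fold tensor
power of the standard representation: they are invariant, linearly independent, and span
the space of invariants. -/
theorem waveTensors_basis_of_invariants (f : Type*) [Field f] [CharZero f] (k n : ℕ)
    (hn : 0 < n) :
    (∀ G : {e : Fin (k * n) ≃ Fin k × Fin n // IsWaveStruct hn e},
      waveTensor f G.val ∈ slInvariants f n (k * n)) ∧
    LinearIndependent f
      (fun G : {e : Fin (k * n) ≃ Fin k × Fin n // IsWaveStruct hn e} =>
        waveTensor f G.val) ∧
    Submodule.span f
        (Set.range fun G : {e : Fin (k * n) ≃ Fin k × Fin n // IsWaveStruct hn e} =>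
          waveTensor f G.val) =
      slInvariants f n (k * n) := by
  classical
  have hmem (G : {e : Fin (k * n) ≃ Fin k × Fin n // IsWaveStruct hn e}) :
      waveTensor f G.val ∈ slInvariants f n (k * n) := waveTensor_mem_slInvariants G.val
  have hli := linearIndependent_waveTensor f k n hn
  have : Module.Finite f (⨂[f] _ : Fin (k * n), (Fin n → f)) :=
    Module.Finite.of_basis (Basis.piTensorProduct fun _ => Pi.basisFun f (Fin n))
  refine ⟨hmem, hli, Submodule.eq_of_le_of_finrank_le
    (Submodule.span_le.2 (Set.range_subset_iff.2 hmem)) ?_⟩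
  rw [finrank_span_eq_card hli]
  let coeffs : slInvariants f n (k * n) →ₗ[f]
      ({e : Fin (k * n) ≃ Fin k × Fin n // IsWaveStruct hn e} → f) :=
    LinearMap.pi fun G => wordCoeff f (fun v => (G.val v).2) ∘ₗ Submodule.subtype _
  have hinj : Function.Injective coeffs := by
    rw [injective_iff_map_eq_zero]
    intro t ht
    by_contra h0
    obtain ⟨e, he, hne⟩ := exists_wordCoeff_ne_zero hn t.2 (by simpa using h0)
    exact hne (congrFun ht ⟨e, he⟩)
  simpa using LinearMap.finrank_le_finrank_of_injective hinj
end
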